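/- arXiv:1902.02387 — 10 statements merged into one kernel-verified Lean document; each statement's English description precedes it below -/
import Mathlib

section
/- Let 𝓜 and 𝓧 be abelian categories with enough projective and enough injective objects, and let (C, S) be an adjoint pair of functors with C : 𝓧 → 𝓜 left adjoint to S : 𝓜 → 𝓧, where S is exact. Then for every N ∈ 𝓜 and X ∈ 𝓧 there exists an exact sequence of abelian groups 0 → Ext¹_𝓜(C(X), N) → Ext¹_𝓧(X, S(N)) → Hom_𝓜(L₁C(X), N) → Ext²_𝓜(C(X), N) → Ext²_𝓧(X, S(N)). -/
/-!
Statement 0 (five term exact sequence, Lemma 1.2 in Holm–Jørgensen,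
"Model categories of quiver representations").

Let `𝓜` and `𝓧` be abelian categories with enough projectives and enough injectives,
and let `(C, S)` be an adjoint pair with `C : 𝓧 ⥤ 𝓜` left adjoint to the exact functor
`S : 𝓜 ⥤ 𝓧`.  Then for every `N ∈ 𝓜` and `X ∈ 𝓧` there is an exact sequence of abelian
groups
`0 → Ext¹_𝓜(C X, N) → Ext¹_𝓧(X, S N) → Hom_𝓜(L₁C X, N) → Ext²_𝓜(C X, N) → Ext²_𝓧(X, S N)`.
-/

open CategoryTheory CategoryTheory.Limits CategoryTheory.Abelian

universe w w' v u v' u'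

namespace CategoryTheory

namespace ShortComplex.ShortExact

variable {𝓜 : Type u} [Category.{v} 𝓜] [Abelian 𝓜] {𝓧 : Type u'} [Category.{v'} 𝓧] [Abelian 𝓧]
  {C : 𝓧 ⥤ 𝓜} [PreservesFiniteColimits C]
  {T : ShortComplex 𝓧} (hT : T.ShortExact)

include hT

/-- A right exact functor `C` maps the short exact sequence `0 → X₁ → X₂ → X₃ → 0` to a short
exact sequence `0 → ker (C g) → C X₂ → C X₃ → 0`. -/
lemma kernel_map_shortExact :
    (ShortComplex.mk (kernel.ι (C.map T.g)) (C.map T.g) (kernel.condition _)).ShortExact where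
  exact := ShortComplex.exact_kernel _
  mono_f := inferInstanceAs (Mono (kernel.ι (C.map T.g)))
  epi_g := by
    have := hT.epi_g
    exact inferInstanceAs (Epi (C.map T.g))

lemma epi_kernel_lift_map [C.PreservesZeroMorphisms] (w : C.map T.f ≫ C.map T.g = 0) :
    Epi (kernel.lift (C.map T.g) (C.map T.f) w) := by
  have := hT.epi_g
  have h := hT.exact.map_of_epi_of_preservesCokernel C inferInstance inferInstance
  exact h.epi_kernelLift

end ShortComplex.ShortExact

namespace Adjunction

variable {𝓜 : Type u} [Category.{v} 𝓜] [Abelian 𝓜] [HasExt.{w} 𝓜]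
  {𝓧 : Type u'} [Category.{v'} 𝓧] [Abelian 𝓧] [HasExt.{w'} 𝓧]
  {C : 𝓧 ⥤ 𝓜} {S : 𝓜 ⥤ 𝓧} (adj : C ⊣ S) [S.Additive]
  [PreservesFiniteLimits S] [PreservesFiniteColimits S]

/-- If `C` is left adjoint to an exact functor `S`, this is the canonical map
`Ext (C.obj X) N n →+ Ext X (S.obj N) n`, which applies `S` and precomposes with the unit. -/
noncomputable def extMap (X : 𝓧) (N : 𝓜) (n : ℕ) :
    Ext.{w} (C.obj X) N n →+ Ext.{w'} X (S.obj N) n :=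
  ((Ext.mk₀ (adj.unit.app X)).precomp (S.obj N) (zero_add n)).comp
    (S.mapExtAddHom (C.obj X) N n)

lemma extMap_apply {X : 𝓧} {N : 𝓜} {n : ℕ} (e : Ext.{w} (C.obj X) N n) :
    (adj.extMap X N n e : Ext.{w'} X (S.obj N) n) =
      (Ext.mk₀ (adj.unit.app X)).comp (e.mapExactFunctor S) (zero_add n) := rfl

lemma extMap_mk₀ {X : 𝓧} {N : 𝓜} (φ : C.obj X ⟶ N) :
    (adj.extMap X N 0 (Ext.mk₀ φ) : Ext.{w'} X (S.obj N) 0) =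
      Ext.mk₀ (adj.homEquiv X N φ) := by
  rw [extMap_apply, Ext.mapExactFunctor_mk₀, Ext.mk₀_comp_mk₀, adj.homEquiv_unit]

variable {T : ShortComplex 𝓧} (hT : T.ShortExact) {I : 𝓜} {i : I ⟶ C.obj T.X₂}
  {wi : i ≫ C.map T.g = 0} (hA : (ShortComplex.mk i (C.map T.g) wi).ShortExact)
  {q : C.obj T.X₁ ⟶ I} (hqi : q ≫ i = C.map T.f)

include hqi in
lemma extMap_extClass_comp {N : 𝓜} {m n : ℕ} (hmn : 1 + m = n) (e : Ext.{w} I N m) :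
    (adj.extMap T.X₃ N n (hA.extClass.comp e hmn) : Ext.{w'} T.X₃ (S.obj N) n) =
      hT.extClass.comp (adj.extMap T.X₁ N m ((Ext.mk₀ q).comp e (zero_add m))) hmn := by
  have comm : (adj.unit.app T.X₁ ≫ S.map q) ≫ S.map i = T.f ≫ adj.unit.app T.X₂ := by
    rw [Category.assoc, ← S.map_comp, hqi]
    exact (adj.unit.naturality T.f).symm
  let φ : T ⟶ (ShortComplex.mk i (C.map T.g) wi).map S :=
    { τ₁ := adj.unit.app T.X₁ ≫ S.map q
      τ₂ := adj.unit.app T.X₂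
      τ₃ := adj.unit.app T.X₃
      comm₁₂ := comm
      comm₂₃ := (adj.unit.naturality T.g).symm }
  have h := ShortComplex.ShortExact.extClass_naturality hT (hA.map_of_exact S) φ
  rw [extMap_apply, extMap_apply, Ext.mapExactFunctor_comp, Ext.mapExactFunctor_comp,
    Ext.mapExactFunctor_mk₀, Ext.mapExactFunctor_extClass, Ext.mk₀_comp_mk₀_assoc,
    ← Ext.comp_assoc_of_second_deg_zero]
  exact (Ext.comp_assoc _ _ _ (zero_add 1) hmn (by lia)).symm.trans
    (congrArg (fun x => x.comp (e.mapExactFunctor S) hmn) h.symm)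

/-- The map `(C.obj X₁ ⟶ N) →+ Ext X₃ (S.obj N) 1` given by the adjunction bijection
followed by composition with the class of a short exact sequence. -/
noncomputable def homToExtOne (N : 𝓜) : (C.obj T.X₁ ⟶ N) →+ Ext.{w'} T.X₃ (S.obj N) 1 :=
  (hT.extClass.precomp (S.obj N) (add_zero 1)).comp
    ((adj.extMap T.X₁ N 0).comp Ext.addEquiv₀.symm.toAddMonoidHom)

lemma homToExtOne_apply {N : 𝓜} (φ : C.obj T.X₁ ⟶ N) :
    (adj.homToExtOne hT N φ : Ext.{w'} T.X₃ (S.obj N) 1) =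
      hT.extClass.comp (Ext.mk₀ (adj.homEquiv _ _ φ)) (add_zero 1) :=
  congrArg (fun x => hT.extClass.comp x (add_zero 1)) (adj.extMap_mk₀ φ)

include hqi in
lemma extMap_extClass_comp_mk₀ {N : 𝓜} (φ : I ⟶ N) :
    (adj.extMap T.X₃ N 1 (hA.extClass.comp (Ext.mk₀ φ) (add_zero 1)) :
      Ext.{w'} T.X₃ (S.obj N) 1) = adj.homToExtOne hT N (q ≫ φ) := by
  rw [adj.extMap_extClass_comp hT hA hqi, Ext.mk₀_comp_mk₀, extMap_mk₀, homToExtOne_apply]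

lemma exists_map_comp_eq_of_homToExtOne_eq_zero {N : 𝓜} (φ : C.obj T.X₁ ⟶ N)
    (hφ : (adj.homToExtOne hT N φ : Ext.{w'} T.X₃ (S.obj N) 1) = 0) :
    ∃ ψ : C.obj T.X₂ ⟶ N, C.map T.f ≫ ψ = φ := by
  rw [homToExtOne_apply] at hφ
  obtain ⟨y, hy⟩ := Ext.contravariant_sequence_exact₁ hT _ _ _ hφ
  obtain ⟨y, rfl⟩ := (Ext.mk₀_bijective _ _).2 y
  rw [Ext.mk₀_comp_mk₀] at hy
  refine ⟨(adj.homEquiv _ _).symm y, (adj.homEquiv _ _).injective ?_⟩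
  rw [adj.homEquiv_naturality_left, Equiv.apply_symm_apply]
  exact (Ext.mk₀_bijective _ _).1 hy

variable [Projective T.X₂]

lemma homToExtOne_surjective (N : 𝓜) :
    Function.Surjective (adj.homToExtOne hT N : _ → Ext.{w'} T.X₃ (S.obj N) 1) := by
  intro e
  obtain ⟨x, rfl⟩ := Ext.contravariant_sequence_exact₃ hT _ e (Ext.eq_zero_of_projective _)
    (add_zero 1)
  obtain ⟨x, rfl⟩ := (Ext.mk₀_bijective _ _).2 x
  exact ⟨(adj.homEquiv _ _).symm x, by rw [homToExtOne_apply, Equiv.apply_symm_apply]⟩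

include hT hA hqi in
lemma extMap_one_injective_of_shortExact [Epi q] (N : 𝓜) :
    Function.Injective (adj.extMap T.X₃ N 1 : Ext.{w} _ N 1 → Ext.{w'} _ (S.obj N) 1) := by
  have := adj.map_projective T.X₂ inferInstance
  rw [injective_iff_map_eq_zero]
  intro e he
  obtain ⟨x, rfl⟩ := Ext.contravariant_sequence_exact₃ hA N e (Ext.eq_zero_of_projective _)
    (add_zero 1)
  obtain ⟨x, rfl⟩ := (Ext.mk₀_bijective _ _).2 x
  rw [adj.extMap_extClass_comp_mk₀ hT hA hqi] at he
  obtain ⟨y, hy⟩ := adj.exists_map_comp_eq_of_homToExtOne_eq_zero hT _ he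
  obtain rfl : i ≫ y = x := by rw [← cancel_epi q, ← hy, reassoc_of% hqi]
  rw [← Ext.mk₀_comp_mk₀]
  exact hA.extClass_comp_assoc _

lemma extMap_one_injective [EnoughProjectives 𝓧] (X : 𝓧) (N : 𝓜) :
    Function.Injective (adj.extMap X N 1 : Ext.{w} _ N 1 → Ext.{w'} _ (S.obj N) 1) := by
  have := adj.left_adjoint_additive
  have := adj.leftAdjoint_preservesColimits
  let T : ShortComplex 𝓧 := ShortComplex.mk (kernel.ι (Projective.π X)) (Projective.π X)
    (kernel.condition _)
  have hT : T.ShortExact :=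
    { exact := ShortComplex.exact_kernel _
      mono_f := inferInstanceAs (Mono (kernel.ι (Projective.π X)))
      epi_g := inferInstanceAs (Epi (Projective.π X)) }
  have : Projective T.X₂ := Projective.projective_over X
  have w : C.map T.f ≫ C.map T.g = 0 := by rw [← C.map_comp, T.zero, C.map_zero]
  have := hT.epi_kernel_lift_map w
  exact adj.extMap_one_injective_of_shortExact hT hT.kernel_map_shortExact
    (kernel.lift_ι _ _ w) N

include hT hA hqi in
/-- The five term exact sequence, computed from a short exact sequence `0 → X₁ → X₂ → X₃ → 0` with
`X₂` projective: `I` is the image of `C X₁ → C X₂`, and `L` is the kernel of this map. -/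
lemma exists_five_term_exact_sequence [EnoughProjectives 𝓧] {L : 𝓜} {l : L ⟶ C.obj T.X₁}
    {wq : l ≫ q = 0} (hB : (ShortComplex.mk l q wq).ShortExact) (N : 𝓜) :
    ∃ (f₂ : Ext.{w'} T.X₃ (S.obj N) 1 →+ (L ⟶ N)) (f₃ : (L ⟶ N) →+ Ext.{w} (C.obj T.X₃) N 2),
      Function.Exact (adj.extMap T.X₃ N 1) f₂ ∧ Function.Exact f₂ f₃ ∧
        Function.Exact f₃ (adj.extMap T.X₃ N 2 : _ → Ext.{w'} T.X₃ (S.obj N) 2) := by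
  have := adj.map_projective T.X₂ inferInstance
  have : Epi q := hB.epi_g
  have hli : l ≫ C.map T.f = 0 := by rw [← hqi, reassoc_of% wq, zero_comp]
  have hsurj := adj.homToExtOne_surjective (S := S) hT N
  let f₂ : Ext.{w'} T.X₃ (S.obj N) 1 →+ (L ⟶ N) :=
    (adj.homToExtOne hT N).liftOfSurjective hsurj
      ⟨Preadditive.leftComp N l, fun φ hφ => by
        obtain ⟨ψ, rfl⟩ := adj.exists_map_comp_eq_of_homToExtOne_eq_zero hT φ hφ
        change l ≫ C.map T.f ≫ ψ = 0
        rw [reassoc_of% hli, zero_comp]⟩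
  have hf₂ (φ : C.obj T.X₁ ⟶ N) : f₂ (adj.homToExtOne hT N φ) = l ≫ φ :=
    AddMonoidHom.liftOfRightInverse_comp_apply _ _ _ _ φ
  let f₃ : (L ⟶ N) →+ Ext.{w} (C.obj T.X₃) N 2 :=
    (hA.extClass.precomp N (show 1 + 1 = 2 from rfl)).comp
      ((hB.extClass.precomp N (add_zero 1)).comp Ext.addEquiv₀.symm.toAddMonoidHom)
  have hf₃ (h : L ⟶ N) : f₃ h =
      hA.extClass.comp (hB.extClass.comp (Ext.mk₀ h) (add_zero 1)) rfl := rfl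
  refine ⟨f₂, f₃, fun a => ⟨fun ha => ?_, ?_⟩, fun h => ⟨fun hh => ?_, ?_⟩,
    fun e => ⟨fun he => ?_, ?_⟩⟩
  · obtain ⟨φ, rfl⟩ := hsurj a
    rw [hf₂] at ha
    let φ' := hB.exact.desc φ ha
    exact ⟨hA.extClass.comp (Ext.mk₀ φ') (add_zero 1), by
      rw [adj.extMap_extClass_comp_mk₀ hT hA hqi]
      exact congrArg _ (hB.exact.g_desc φ ha)⟩
  · rintro ⟨e, rfl⟩
    obtain ⟨x, rfl⟩ := Ext.contravariant_sequence_exact₃ hA N e (Ext.eq_zero_of_projective _)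
      (add_zero 1)
    obtain ⟨x, rfl⟩ := (Ext.mk₀_bijective _ _).2 x
    rw [adj.extMap_extClass_comp_mk₀ hT hA hqi, hf₂, reassoc_of% wq, zero_comp]
  · rw [hf₃] at hh
    obtain ⟨y, hy⟩ := Ext.contravariant_sequence_exact₁ hA _ _ _ hh
    rw [Ext.eq_zero_of_projective y, Ext.comp_zero] at hy
    obtain ⟨x, hx⟩ := Ext.contravariant_sequence_exact₁ hB _ _ _ hy.symm
    obtain ⟨x, rfl⟩ := (Ext.mk₀_bijective _ _).2 x
    rw [Ext.mk₀_comp_mk₀] at hx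
    exact ⟨adj.homToExtOne hT N x, (hf₂ x).trans ((Ext.mk₀_bijective _ _).1 hx)⟩
  · rintro ⟨a, rfl⟩
    obtain ⟨φ, rfl⟩ := hsurj a
    rw [hf₂, hf₃, ← Ext.mk₀_comp_mk₀]
    exact (congrArg (hA.extClass.comp · rfl) (hB.extClass_comp_assoc _)).trans
      (Ext.comp_zero _ _ _ _ _)
  · obtain ⟨e', rfl⟩ := Ext.contravariant_sequence_exact₃ hA N e (Ext.eq_zero_of_projective _)
      (show 1 + 1 = 2 from rfl)
    rw [adj.extMap_extClass_comp hT hA hqi] at he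
    obtain ⟨y, hy⟩ := Ext.contravariant_sequence_exact₁ hT _ _ _ he
    rw [Ext.eq_zero_of_projective y, Ext.comp_zero] at hy
    have hz := (map_eq_zero_iff _ (adj.extMap_one_injective T.X₁ N)).1 hy.symm
    obtain ⟨x, rfl⟩ := Ext.contravariant_sequence_exact₃ hB _ e' hz (add_zero 1)
    obtain ⟨x, rfl⟩ := (Ext.mk₀_bijective _ _).2 x
    exact ⟨x, rfl⟩
  · rintro ⟨h, rfl⟩
    rw [hf₃, adj.extMap_extClass_comp hT hA hqi]
    have hz : (Ext.mk₀ q).comp (hB.extClass.comp (Ext.mk₀ h) (add_zero 1)) (zero_add 1) = 0 :=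
      hB.comp_extClass_assoc _ _
    rw [hz, map_zero, Ext.comp_zero]

end Adjunction

section

variable {𝓜 : Type u} [Category.{v} 𝓜] [Abelian 𝓜]
  {𝓧 : Type u'} [Category.{v'} 𝓧] [Abelian 𝓧]

/-- The short complex `K ⟶ P₀ ⟶ X`, where `K` is the first syzygy of a projective resolution. -/
noncomputable abbrev ProjectiveResolution.syzygyShortComplex {X : 𝓧}
    (P : ProjectiveResolution X) : ShortComplex 𝓧 :=
  ShortComplex.mk (kernel.ι (P.π.f 0)) (P.π.f 0) (kernel.condition _)

lemma ProjectiveResolution.syzygyShortComplex_shortExact {X : 𝓧}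
    (P : ProjectiveResolution X) : P.syzygyShortComplex.ShortExact where
  exact := ShortComplex.exact_kernel _
  mono_f := inferInstanceAs (Mono (kernel.ι (P.π.f 0)))
  epi_g := inferInstanceAs (Epi (P.π.f 0))

/-- The first left derived functor of a right exact functor `C` at `X` is the kernel of
`C K ⟶ C P₀`, where `K` is the first syzygy of a projective resolution `P` of `X`. -/
noncomputable def ProjectiveResolution.leftDerivedOneIsoKernel [EnoughProjectives 𝓧] {X : 𝓧}
    (P : ProjectiveResolution X) (C : 𝓧 ⥤ 𝓜) [C.Additive] [PreservesFiniteColimits C] :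
    (C.leftDerived 1).obj X ≅ kernel (C.map (kernel.ι (P.π.f 0))) := by
  let p : P.complex.X 1 ⟶ kernel (P.π.f 0) :=
    kernel.lift (P.π.f 0) (P.complex.d 1 0) P.complex_d_comp_π_f_zero
  have hp : p ≫ kernel.ι (P.π.f 0) = P.complex.d 1 0 := kernel.lift_ι _ _ _
  have wp : P.complex.d 2 1 ≫ p = 0 := by
    rw [← cancel_mono (kernel.ι (P.π.f 0)), Category.assoc, hp, P.complex.d_comp_d, zero_comp]
  have : Epi p := P.exact₀.epi_kernelLift
  have hex : (ShortComplex.mk _ _ wp).Exact := by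
    let φ : ShortComplex.mk _ _ wp ⟶ ShortComplex.mk _ _ (P.complex.d_comp_d 2 1 0) :=
      { τ₁ := 𝟙 _
        τ₂ := 𝟙 _
        τ₃ := kernel.ι (P.π.f 0) }
    have : Epi φ.τ₁ := inferInstanceAs (Epi (𝟙 _))
    have : IsIso φ.τ₂ := inferInstanceAs (IsIso (𝟙 _))
    have : Mono φ.τ₃ := inferInstanceAs (Mono (kernel.ι (P.π.f 0)))
    exact (ShortComplex.exact_iff_of_epi_of_isIso_of_mono φ).2 (P.exact_succ 0)
  have : Epi (ShortComplex.mk _ _ wp).g := this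
  let K := (C.mapHomologicalComplex (ComplexShape.down ℕ)).obj P.complex
  have wCp : C.map (P.complex.d 2 1) ≫ C.map p = 0 := by rw [← C.map_comp, wp, C.map_zero]
  let hc : IsColimit (CokernelCofork.ofπ (C.map p) wCp) :=
    CokernelCofork.mapIsColimit _ hex.gIsCokernel C
  have hdesc : hc.desc (CokernelCofork.ofπ _ (K.d_comp_d 2 1 0)) =
      C.map (kernel.ι (P.π.f 0)) :=
    Cofork.IsColimit.hom_ext hc ((hc.fac _ _).trans ((congrArg C.map hp.symm).trans
      (C.map_comp _ _)))
  have wι : kernel.ι (C.map (kernel.ι (P.π.f 0))) ≫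
      hc.desc (CokernelCofork.ofπ _ (K.d_comp_d 2 1 0)) = 0 := by
    rw [hdesc]
    exact kernel.condition _
  let data : (K.sc' 2 1 0).RightHomologyData :=
    { Q := C.obj (kernel (P.π.f 0))
      H := kernel (C.map (kernel.ι (P.π.f 0)))
      p := C.map p
      ι := kernel.ι _
      wp := wCp
      hp := hc
      wι := wι
      hι := KernelFork.IsLimit.ofι' _ wι fun {A} k hk =>
        ⟨kernel.lift _ k (by rwa [hdesc] at hk), kernel.lift_ι _ _ _⟩ }
  exact P.isoLeftDerivedObj C 1 ≪≫ (K.homologyIsoSc' 2 1 0 (by simp) (by simp)) ≪≫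
    data.homologyIso

end

end CategoryTheory

theorem five_term_exact_sequence_of_adjunction_left
    {𝓜 : Type u} [Category.{v} 𝓜] [Abelian 𝓜]
    [EnoughProjectives 𝓜] [EnoughInjectives 𝓜] [HasExt.{w} 𝓜]
    {𝓧 : Type u'} [Category.{v'} 𝓧] [Abelian 𝓧]
    [EnoughProjectives 𝓧] [EnoughInjectives 𝓧] [HasExt.{w'} 𝓧]
    (C : 𝓧 ⥤ 𝓜) (S : 𝓜 ⥤ 𝓧) (adj : C ⊣ S) [C.Additive]
    [PreservesFiniteLimits S] [PreservesFiniteColimits S]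
    (N : 𝓜) (X : 𝓧) :
    ∃ (f₁ : Ext (C.obj X) N 1 →+ Ext X (S.obj N) 1)
      (f₂ : Ext X (S.obj N) 1 →+ (((C.leftDerived 1).obj X ⟶ N)))
      (f₃ : (((C.leftDerived 1).obj X ⟶ N)) →+ Ext (C.obj X) N 2)
      (f₄ : Ext (C.obj X) N 2 →+ Ext X (S.obj N) 2),
      Function.Injective f₁ ∧
      Function.Exact f₁ f₂ ∧
      Function.Exact f₂ f₃ ∧
      Function.Exact f₃ f₄ := by
  have := adj.right_adjoint_additive
  have := adj.leftAdjoint_preservesColimits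
  let P := projectiveResolution X
  let T := P.syzygyShortComplex
  have hT : T.ShortExact := P.syzygyShortComplex_shortExact
  have : Projective T.X₂ := P.projective 0
  have w : C.map T.f ≫ C.map T.g = 0 := by rw [← C.map_comp, T.zero, C.map_zero]
  let q := kernel.lift (C.map T.g) (C.map T.f) w
  have hqi : q ≫ kernel.ι (C.map T.g) = C.map T.f := kernel.lift_ι _ _ w
  have : Epi q := hT.epi_kernel_lift_map w
  let α : (C.leftDerived 1).obj X ≅ kernel (C.map T.f) := P.leftDerivedOneIsoKernel C
  have wq : kernel.ι (C.map T.f) ≫ q = 0 := by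
    rw [← cancel_mono (kernel.ι (C.map T.g)), Category.assoc, hqi, kernel.condition, zero_comp]
  have hB : (ShortComplex.mk (kernel.ι (C.map T.f)) q wq).ShortExact :=
    { exact :=
        let φ : ShortComplex.mk (kernel.ι (C.map T.f)) q wq ⟶
            ShortComplex.mk (kernel.ι (C.map T.f)) (C.map T.f) (kernel.condition _) :=
          { τ₁ := 𝟙 _
            τ₂ := 𝟙 _
            τ₃ := kernel.ι (C.map T.g)
            comm₂₃ := (Category.id_comp _).trans hqi.symm }
        have : Epi φ.τ₁ := inferInstanceAs (Epi (𝟙 _))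
        have : IsIso φ.τ₂ := inferInstanceAs (IsIso (𝟙 _))
        have : Mono φ.τ₃ := inferInstanceAs (Mono (kernel.ι (C.map T.g)))
        (ShortComplex.exact_iff_of_epi_of_isIso_of_mono φ).2 (ShortComplex.exact_kernel _)
      mono_f := inferInstanceAs (Mono (kernel.ι (C.map T.f)))
      epi_g := this }
  obtain ⟨f₂, f₃, h₁₂, h₂₃, h₃₄⟩ :=
    adj.exists_five_term_exact_sequence hT hT.kernel_map_shortExact hqi hB N
  let β : (kernel (C.map T.f) ⟶ N) ≃+ ((C.leftDerived 1).obj X ⟶ N) :=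
    { toFun φ := α.hom ≫ φ
      invFun φ := α.inv ≫ φ
      left_inv φ := by simp
      right_inv φ := by simp
      map_add' φ ψ := by simp }
  refine ⟨adj.extMap X N 1, β.toAddMonoidHom.comp f₂, f₃.comp β.symm.toAddMonoidHom,
    adj.extMap X N 2, adj.extMap_one_injective X N, fun a => ?_, fun h => ?_, fun e => ?_⟩
  · exact (map_eq_zero_iff β β.injective).trans (h₁₂ a)
  · exact (h₂₃ (β.symm h)).trans (exists_congr fun a => β.eq_symm_apply)
  · exact (h₃₄ e).trans β.symm.surjective.exists
end

section
/- In the abstract setup, let 𝓒 be a class of objects of 𝓜, and assume that for each non-zero M ∈ 𝓜 there is an injective object I of 𝓜 which belongs to 𝓒 and satisfies Hom_𝓜(M, I) ≠ 0. Then Φ(⊥𝓒) = ⊥{S_j(C) | j ∈ J, C ∈ 𝓒}, i.e. an object X ∈ 𝓧 satisfies (for every j ∈ J, C_j(X) ∈ ⊥𝓒 and L₁C_j(X) = 0) if and only if Ext¹_𝓧(X, S_j(C)) = 0 for all j ∈ J and all C ∈ 𝓒. -/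
/-!
Statement 3 (Lemma 1.9(i)): `Φ(⊥𝓒) = ⊥{S_j(C) | j ∈ J, C ∈ 𝓒}` when every nonzero object of `𝓜` admits a nonzero morphism to an injective object belonging to `𝓒`.
(Holm–Jørgensen, "Model categories of quiver representations".)
-/

open CategoryTheory CategoryTheory.Limits CategoryTheory.Abelian

universe w w' v u v' u'

section Defs

variable {𝓨 : Type u} [Category.{v} 𝓨] [Abelian 𝓨] [HasExt.{w} 𝓨]

/-- `Γ^⊥ = {Y | Ext¹(C, Y) = 0 for all C ∈ Γ}`. -/
def rightPerp (Γ : Set 𝓨) : Set 𝓨 :=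
  {Y | ∀ C ∈ Γ, Subsingleton (Ext C Y 1)}

/-- `⊥Δ = {Y | Ext¹(Y, D) = 0 for all D ∈ Δ}`. -/
def leftPerp (Δ : Set 𝓨) : Set 𝓨 :=
  {Y | ∀ D ∈ Δ, Subsingleton (Ext Y D 1)}

/-- `(Γ, Δ)` is a cotorsion pair if `Γ = ⊥Δ` and `Γ^⊥ = Δ`. -/
def IsCotorsionPair (Γ Δ : Set 𝓨) : Prop :=
  Γ = leftPerp Δ ∧ rightPerp Γ = Δ

/-- `Γ` is closed under kernels of epimorphisms. -/
def ClosedUnderKernelsOfEpis (Γ : Set 𝓨) : Prop :=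
  ∀ ⦃X Y : 𝓨⦄ (f : X ⟶ Y), Epi f → X ∈ Γ → Y ∈ Γ → (kernel f : 𝓨) ∈ Γ

/-- `Δ` is closed under cokernels of monomorphisms. -/
def ClosedUnderCokernelsOfMonos (Δ : Set 𝓨) : Prop :=
  ∀ ⦃X Y : 𝓨⦄ (f : X ⟶ Y), Mono f → X ∈ Δ → Y ∈ Δ → (cokernel f : 𝓨) ∈ Δ

/-- A cotorsion pair `(Γ, Δ)` is hereditary if `Γ` is closed under kernels of
epimorphisms and `Δ` is closed under cokernels of monomorphisms. -/
def IsHereditary (Γ Δ : Set 𝓨) : Prop :=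
  ClosedUnderKernelsOfEpis Γ ∧ ClosedUnderCokernelsOfMonos Δ

end Defs

section Setup

variable {𝓜 : Type u} [Category.{v} 𝓜] [Abelian 𝓜]
  [EnoughProjectives 𝓜] [EnoughInjectives 𝓜] [HasExt.{w} 𝓜]
variable {𝓧 : Type u'} [Category.{v'} 𝓧] [Abelian 𝓧]
  [EnoughProjectives 𝓧] [EnoughInjectives 𝓧] [HasExt.{w'} 𝓧]
variable {J : Type*} (Cf Kf : J → (𝓧 ⥤ 𝓜)) (Sf : J → (𝓜 ⥤ 𝓧))

/-- `Φ(𝓒) = {X | ∀ j, C_j(X) ∈ 𝓒 and L₁C_j(X) = 0}`. -/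
def Phi [∀ j, (Cf j).Additive] (𝓒 : Set 𝓜) : Set 𝓧 :=
  {X | ∀ j, (Cf j).obj X ∈ 𝓒 ∧ IsZero (((Cf j).leftDerived 1).obj X)}

/-- `Ψ(𝓒) = {X | ∀ j, K_j(X) ∈ 𝓒 and R¹K_j(X) = 0}`. -/
def Psi [∀ j, (Kf j).Additive] (𝓒 : Set 𝓜) : Set 𝓧 :=
  {X | ∀ j, (Kf j).obj X ∈ 𝓒 ∧ IsZero (((Kf j).rightDerived 1).obj X)}

/-- `𝓔_L = {X | ∀ j, L₁C_j(X) = 0}`. -/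
def EL [∀ j, (Cf j).Additive] : Set 𝓧 :=
  {X | ∀ j, IsZero (((Cf j).leftDerived 1).obj X)}

/-- `𝓔_R = {X | ∀ j, R¹K_j(X) = 0}`. -/
def ER [∀ j, (Kf j).Additive] : Set 𝓧 :=
  {X | ∀ j, IsZero (((Kf j).rightDerived 1).obj X)}

end Setup

namespace CategoryTheory

/-- If `A ⟶ B ⟶ K ⟶ 0` is exact, then `A ⟶ B ⟶ D` is exact, where the second morphism is the
composition with `i : K ⟶ D`, if and only if `i` is a monomorphism. -/
lemma ShortComplex.Exact.exact_comp_iff_mono {C : Type*} [Category* C] [Abelian C]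
    {S : ShortComplex C} (hS : S.Exact) [Epi S.g] {D : C} (i : S.X₃ ⟶ D) :
    (ShortComplex.mk S.f (S.g ≫ i) (by simp)).Exact ↔ Mono i := by
  refine ⟨fun h ↦ Preadditive.mono_of_cancel_zero _ fun {G} k hk ↦ ?_, fun _ ↦ ?_⟩
  · obtain ⟨A, π, _, b, hb⟩ := surjective_up_to_refinements_of_epi S.g k
    obtain ⟨A', π', _, a, ha⟩ := h.exact_up_to_refinements b (by
      dsimp
      rw [← Category.assoc, ← hb, Category.assoc, hk, comp_zero])
    dsimp at ha
    rw [← cancel_epi π, ← cancel_epi π', hb, ← Category.assoc, ha]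
    simp
  · let φ : S ⟶ ShortComplex.mk S.f (S.g ≫ i) (by simp) :=
      { τ₁ := 𝟙 _, τ₂ := 𝟙 _, τ₃ := i }
    have : Epi φ.τ₁ := inferInstanceAs (Epi (𝟙 _))
    have : IsIso φ.τ₂ := inferInstanceAs (IsIso (𝟙 _))
    have : Mono φ.τ₃ := inferInstanceAs (Mono i)
    exact (ShortComplex.exact_iff_of_epi_of_isIso_of_mono φ).1 hS

lemma ShortComplex.ShortExact.exists_comp_eq_of_subsingleton_ext {C : Type*} [Category* C]
    [Abelian C] [HasExt.{w} C] {S : ShortComplex C} (hS : S.ShortExact) {Y : C}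
    [Subsingleton (Ext S.X₃ Y 1)] (f : S.X₁ ⟶ Y) : ∃ g : S.X₂ ⟶ Y, S.f ≫ g = f := by
  obtain ⟨x, hx⟩ := Ext.contravariant_sequence_exact₁ hS Y (Ext.mk₀ f) (add_zero 1)
    (Subsingleton.elim _ _)
  obtain ⟨g, rfl⟩ := (Ext.mk₀_bijective _ _).surjective x
  exact ⟨g, (Ext.mk₀_bijective _ _).injective (by rw [← hx, Ext.mk₀_comp_mk₀])⟩

lemma ShortComplex.ShortExact.subsingleton_ext_one_iff {C : Type*} [Category* C]
    [Abelian C] [HasExt.{w} C] {S : ShortComplex C} (hS : S.ShortExact) [Projective S.X₂] (Y : C) :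
    Subsingleton (Ext S.X₃ Y 1) ↔ ∀ f : S.X₁ ⟶ Y, ∃ g : S.X₂ ⟶ Y, S.f ≫ g = f := by
  refine ⟨fun _ f ↦ hS.exists_comp_eq_of_subsingleton_ext f,
    fun h ↦ subsingleton_of_forall_eq 0 fun e ↦ ?_⟩
  obtain ⟨x, rfl⟩ := Ext.contravariant_sequence_exact₃ hS Y e (Ext.eq_zero_of_projective _)
    (add_zero 1)
  obtain ⟨f, rfl⟩ := (Ext.mk₀_bijective _ _).surjective x
  obtain ⟨g, rfl⟩ := h f
  rw [← Ext.mk₀_comp_mk₀, hS.extClass_comp_assoc]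

namespace ProjectiveResolution

variable {C : Type*} [Category* C] [Abelian C] {X : C} (P : ProjectiveResolution X)

/-- The short complex `Ω ⟶ P₀ ⟶ X` attached to a projective resolution of `X`, where `Ω` is the
first syzygy. -/
noncomputable def syzygyShortComplex_s3 : ShortComplex C :=
  ShortComplex.mk (X₁ := kernel (P.π.f 0)) (X₂ := P.complex.X 0) (X₃ := X)
    (kernel.ι (P.π.f 0)) (P.π.f 0) (kernel.condition _)

lemma syzygyShortComplex_shortExact_s3 : P.syzygyShortComplex_s3.ShortExact where
  exact := ShortComplex.exact_of_f_is_kernel _ (kernelIsKernel (P.π.f 0))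
  mono_f := inferInstanceAs (Mono (kernel.ι (P.π.f 0)))
  epi_g := inferInstanceAs (Epi (P.π.f 0))

instance : Projective P.syzygyShortComplex_s3.X₂ := P.projective 0

/-- The canonical morphism `P₁ ⟶ Ω` onto the first syzygy. -/
noncomputable def toSyzygy : P.complex.X 1 ⟶ P.syzygyShortComplex_s3.X₁ :=
  kernel.lift (P.π.f 0) (P.complex.d 1 0) P.complex_d_comp_π_f_zero

lemma toSyzygy_comp_f : P.toSyzygy ≫ P.syzygyShortComplex_s3.f = P.complex.d 1 0 :=
  kernel.lift_ι _ _ _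

instance : Epi P.toSyzygy := P.exact₀.epi_kernelLift

lemma d_comp_toSyzygy : P.complex.d 2 1 ≫ P.toSyzygy = 0 := by
  have := P.syzygyShortComplex_shortExact_s3.mono_f
  rw [← cancel_mono P.syzygyShortComplex_s3.f, Category.assoc, toSyzygy_comp_f, zero_comp]
  exact P.complex.d_comp_d 2 1 0

lemma exact_toSyzygy : (ShortComplex.mk _ _ P.d_comp_toSyzygy).Exact := by
  let φ : ShortComplex.mk _ _ P.d_comp_toSyzygy ⟶ ShortComplex.mk _ _ (P.complex.d_comp_d 2 1 0) :=
    { τ₁ := 𝟙 _, τ₂ := 𝟙 _, τ₃ := P.syzygyShortComplex_s3.f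
      comm₂₃ := (Category.id_comp _).trans P.toSyzygy_comp_f.symm }
  have : Epi φ.τ₁ := inferInstanceAs (Epi (𝟙 _))
  have : IsIso φ.τ₂ := inferInstanceAs (IsIso (𝟙 _))
  have : Mono φ.τ₃ := P.syzygyShortComplex_shortExact_s3.mono_f
  exact (ShortComplex.exact_iff_of_epi_of_isIso_of_mono φ).2 (P.exact_succ 0)

lemma isZero_leftDerived_one_iff [HasProjectiveResolutions C] {D : Type*} [Category* D]
    [Abelian D] (F : C ⥤ D) [F.Additive] [PreservesFiniteColimits F] :
    IsZero ((F.leftDerived 1).obj X) ↔ Mono (F.map P.syzygyShortComplex_s3.f) := by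
  have hS : ((ShortComplex.mk _ _ P.d_comp_toSyzygy).map F).Exact :=
    P.exact_toSyzygy.map_of_epi_of_preservesCokernel F
      (inferInstanceAs (Epi P.toSyzygy)) inferInstance
  have : Epi ((ShortComplex.mk _ _ P.d_comp_toSyzygy).map F).g :=
    inferInstanceAs (Epi (F.map P.toSyzygy))
  have h : F.map P.toSyzygy ≫ F.map P.syzygyShortComplex_s3.f = F.map (P.complex.d 1 0) :=
    (F.map_comp _ _).symm.trans (congrArg F.map P.toSyzygy_comp_f)
  rw [(P.isoLeftDerivedObj F 1).isZero_iff]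
  refine Iff.trans ?_ (hS.exact_comp_iff_mono (F.map P.syzygyShortComplex_s3.f))
  refine (HomologicalComplex.exactAt_iff_isZero_homology _ _).symm.trans ?_
  rw [HomologicalComplex.exactAt_iff' _ 2 1 0 (by simp) (by simp)]
  exact ShortComplex.exact_iff_of_iso (ShortComplex.isoMk (Iso.refl _) (Iso.refl _) (Iso.refl _)
    ((Category.id_comp _).trans (Category.comp_id _).symm)
    ((Category.id_comp _).trans (h.trans (Category.comp_id _).symm)))

end ProjectiveResolution

lemma Adjunction.forall_exists_comp_eq_iff {C D : Type*} [Category* C] [Category* D]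
    {F : C ⥤ D} {G : D ⥤ C} (adj : F ⊣ G) {A B : C} (i : A ⟶ B) (Y : D) :
    (∀ f : A ⟶ G.obj Y, ∃ g : B ⟶ G.obj Y, i ≫ g = f) ↔
      ∀ f : F.obj A ⟶ Y, ∃ g : F.obj B ⟶ Y, F.map i ≫ g = f := by
  refine ⟨fun h f ↦ ?_, fun h f ↦ ?_⟩
  · obtain ⟨g, hg⟩ := h (adj.homEquiv _ _ f)
    exact ⟨(adj.homEquiv _ _).symm g, by
      rw [← adj.homEquiv_naturality_left_symm, hg, Equiv.symm_apply_apply]⟩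
  · obtain ⟨g, hg⟩ := h ((adj.homEquiv _ _).symm f)
    exact ⟨adj.homEquiv _ _ g, by
      rw [← adj.homEquiv_naturality_left, hg, Equiv.apply_symm_apply]⟩

/-- If every nonzero object has a nonzero morphism to an injective object in `𝓒`, then a morphism
along which all morphisms to objects of `𝓒` extend is a monomorphism. -/
lemma mono_of_forall_exists_comp_eq {C : Type*} [Category* C] [Abelian C] {𝓒 : Set C}
    (h𝓒 : ∀ M : C, ¬ IsZero M → ∃ I : C, Injective I ∧ I ∈ 𝓒 ∧ ∃ f : M ⟶ I, f ≠ 0)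
    {A B : C} (i : A ⟶ B) (hi : ∀ Y ∈ 𝓒, ∀ f : A ⟶ Y, ∃ g : B ⟶ Y, i ≫ g = f) : Mono i := by
  refine Preadditive.mono_of_isZero_kernel _ (not_not.1 fun hK ↦ ?_)
  obtain ⟨I, _, hI, f, hf⟩ := h𝓒 _ hK
  obtain ⟨g, hg⟩ := hi I hI (Injective.factorThru f (kernel.ι i))
  exact hf (by rw [← Injective.comp_factorThru f (kernel.ι i), ← hg, kernel.condition_assoc,
    zero_comp])

end CategoryTheory

theorem phi_leftPerp_eq
    {𝓜 : Type u} [Category.{v} 𝓜] [Abelian 𝓜]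
    [EnoughProjectives 𝓜] [EnoughInjectives 𝓜] [HasExt.{w} 𝓜]
    {𝓧 : Type u'} [Category.{v'} 𝓧] [Abelian 𝓧]
    [EnoughProjectives 𝓧] [EnoughInjectives 𝓧] [HasExt.{w'} 𝓧]
    {J : Type*} (Cf Kf : J → (𝓧 ⥤ 𝓜)) (Sf : J → (𝓜 ⥤ 𝓧))
    [∀ j, (Cf j).Additive] [∀ j, (Kf j).Additive]
    (adjCS : ∀ j, Cf j ⊣ Sf j) (adjSK : ∀ j, Sf j ⊣ Kf j)
    (𝓒 : Set 𝓜)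
    (h𝓒 : ∀ M : 𝓜, ¬ IsZero M → ∃ I : 𝓜, Injective I ∧ I ∈ 𝓒 ∧ ∃ f : M ⟶ I, f ≠ 0) :
    Phi Cf (leftPerp 𝓒) =
      {X : 𝓧 | ∀ (j : J), ∀ C ∈ 𝓒, Subsingleton (Ext X ((Sf j).obj C) 1)} := by
  have (j : J) : PreservesColimitsOfSize.{0, 0} (Cf j) := (adjCS j).leftAdjoint_preservesColimits
  have (j : J) : PreservesColimitsOfSize.{0, 0} (Sf j) := (adjSK j).leftAdjoint_preservesColimits
  ext X
  simp only [Phi, leftPerp, Set.mem_ofPred_eq]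
  refine forall_congr' fun j ↦ ?_
  let P := projectiveResolution X
  have hS := P.syzygyShortComplex_shortExact_s3
  have hX (Y : 𝓜) : Subsingleton (Ext X ((Sf j).obj Y) 1) ↔
      ∀ f : (Cf j).obj P.syzygyShortComplex_s3.X₁ ⟶ Y,
        ∃ g, (Cf j).map P.syzygyShortComplex_s3.f ≫ g = f :=
    (hS.subsingleton_ext_one_iff ((Sf j).obj Y)).trans
      ((adjCS j).forall_exists_comp_eq_iff P.syzygyShortComplex_s3.f Y)
  have hCS (_ : Mono ((Cf j).map P.syzygyShortComplex_s3.f)) :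
      (P.syzygyShortComplex_s3.map (Cf j)).ShortExact :=
    have := hS.epi_g
    { exact := hS.exact.map_of_epi_of_preservesCokernel (Cf j) hS.epi_g inferInstance
      mono_f := by assumption
      epi_g := inferInstanceAs (Epi ((Cf j).map P.syzygyShortComplex_s3.g)) }
  have : Projective (P.syzygyShortComplex_s3.map (Cf j)).X₂ :=
    (adjCS j).map_projective _ (P.projective 0)
  simp only [P.isZero_leftDerived_one_iff (Cf j), hX]
  refine ⟨fun ⟨h, hm⟩ Y hY ↦ ((hCS hm).subsingleton_ext_one_iff Y).1 (h Y hY), fun h ↦ ?_⟩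
  have hm := mono_of_forall_exists_comp_eq h𝓒 _ h
  exact ⟨fun Y hY ↦ ((hCS hm).subsingleton_ext_one_iff Y).2 (h Y hY), hm⟩
end

section
/- In the abstract setup, let 𝓒 be a class of objects of 𝓜, and assume that for each non-zero M ∈ 𝓜 there is a projective object P of 𝓜 which belongs to 𝓒 and satisfies Hom_𝓜(P, M) ≠ 0. Then Ψ(𝓒^⊥) = {S_j(C) | j ∈ J, C ∈ 𝓒}^⊥, i.e. an object X ∈ 𝓧 satisfies (for every j ∈ J, K_j(X) ∈ 𝓒^⊥ and R¹K_j(X) = 0) if and only if Ext¹_𝓧(S_j(C), X) = 0 for all j ∈ J and all C ∈ 𝓒. -/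
/-!
Statement 4 (Lemma 1.9(ii)): `Ψ(𝓒^⊥) = {S_j(C) | j ∈ J, C ∈ 𝓒}^⊥` when every nonzero object of `𝓜` admits a nonzero morphism from a projective object belonging to `𝓒`.
(Holm–Jørgensen, "Model categories of quiver representations".)
-/

open CategoryTheory CategoryTheory.Limits CategoryTheory.Abelian

universe w w' v u v' u'

namespace CategoryTheory

section FirstCosyzygy

variable {𝓐 : Type u} [Category.{v} 𝓐] [Abelian 𝓐]

/-- The short complex `X ⟶ I⁰ ⟶ ker (I¹ ⟶ I²)` attached to an injective resolution of `X`. -/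
noncomputable def InjectiveResolution.firstCosyzygy {X : 𝓐} (I : InjectiveResolution X) :
    ShortComplex 𝓐 where
  X₁ := X
  X₂ := I.cocomplex.X 0
  X₃ := kernel (I.cocomplex.d 1 2)
  f := I.ι.f 0
  g := kernel.lift (I.cocomplex.d 1 2) (I.cocomplex.d 0 1) (I.complex_d_comp 0)
  zero := (cancel_mono (kernel.ι (I.cocomplex.d 1 2))).1 <|
    (Category.assoc _ _ _).trans <| (congrArg (I.ι.f 0 ≫ ·) (kernel.lift_ι _ _ _)).trans <|
      I.ι_f_zero_comp_complex_d.trans zero_comp.symm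

lemma InjectiveResolution.shortExact_firstCosyzygy {X : 𝓐} (I : InjectiveResolution X) :
    I.firstCosyzygy.ShortExact where
  exact := by
    let φ : I.firstCosyzygy ⟶
        ShortComplex.mk (I.ι.f 0) (I.cocomplex.d 0 1) I.ι_f_zero_comp_complex_d :=
      { τ₁ := 𝟙 _
        τ₂ := 𝟙 _
        τ₃ := kernel.ι _
        comm₁₂ := (Category.id_comp _).trans (Category.comp_id _).symm
        comm₂₃ := (Category.id_comp _).trans (kernel.lift_ι _ _ _).symm }
    have : Epi φ.τ₁ := inferInstanceAs (Epi (𝟙 _))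
    have : IsIso φ.τ₂ := inferInstanceAs (IsIso (𝟙 _))
    have : Mono φ.τ₃ := inferInstanceAs (Mono (kernel.ι _))
    exact (ShortComplex.exact_iff_of_epi_of_isIso_of_mono φ).2 I.exact₀
  mono_f := inferInstanceAs (Mono (I.ι.f 0))
  epi_g := (ShortComplex.exact_iff_epi_kernel_lift _).1 (I.exact_succ 0)

/-- The first right derived functor of a kernel-preserving functor vanishes at `X` if and only if
the functor preserves the epimorphism from `I⁰` onto the first cosyzygy of `X`. -/
lemma InjectiveResolution.isZero_rightDerived_one_obj_iff [EnoughInjectives 𝓐]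
    {𝓑 : Type u'} [Category.{v'} 𝓑] [Abelian 𝓑] (F : 𝓐 ⥤ 𝓑) [F.Additive]
    [PreservesFiniteLimits F] {X : 𝓐} (I : InjectiveResolution X) :
    IsZero ((F.rightDerived 1).obj X) ↔ Epi (F.map I.firstCosyzygy.g) := by
  rw [(I.isoRightDerivedObj F 1).isZero_iff]
  refine (HomologicalComplex.exactAt_iff_isZero_homology _ _).symm.trans ?_
  rw [HomologicalComplex.exactAt_iff' _ 0 1 2 (by simp) (by simp),
    ShortComplex.exact_iff_epi_kernel_lift]
  have h : F.map I.firstCosyzygy.g ≫ kernelComparison (I.cocomplex.d 1 2) F =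
      kernel.lift (F.map (I.cocomplex.d 1 2)) (F.map (I.cocomplex.d 0 1))
        (by rw [← F.map_comp, I.complex_d_comp 0, F.map_zero]) :=
    map_lift_kernelComparison _ _ _
  change Epi (kernel.lift (F.map (I.cocomplex.d 1 2)) (F.map (I.cocomplex.d 0 1)) _) ↔ _
  rw [← h]
  exact epi_comp_iff_of_isIso _ (kernelComparison (I.cocomplex.d 1 2) F)

end FirstCosyzygy

section Lifting

variable {𝓐 : Type u} [Category.{v} 𝓐] [Abelian 𝓐] [HasExt.{w} 𝓐]

lemma ShortComplex.ShortExact.exists_lift_of_subsingleton_ext {S : ShortComplex 𝓐}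
    (hS : S.ShortExact) {A : 𝓐} (h : Subsingleton (Ext A S.X₁ 1)) (a : A ⟶ S.X₃) :
    ∃ b : A ⟶ S.X₂, b ≫ S.g = a := by
  obtain ⟨x, hx⟩ := Ext.covariant_sequence_exact₃ A hS (Ext.mk₀ a) (zero_add 1)
    (Subsingleton.elim _ _)
  obtain ⟨b, rfl⟩ := (Ext.mk₀_bijective A S.X₂).2 x
  exact ⟨b, (Ext.mk₀_bijective A S.X₃).1 (by rwa [Ext.mk₀_comp_mk₀] at hx)⟩

lemma ShortComplex.ShortExact.subsingleton_ext_iff {S : ShortComplex 𝓐}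
    (hS : S.ShortExact) [Injective S.X₂] (A : 𝓐) :
    Subsingleton (Ext A S.X₁ 1) ↔ ∀ a : A ⟶ S.X₃, ∃ b : A ⟶ S.X₂, b ≫ S.g = a := by
  refine ⟨hS.exists_lift_of_subsingleton_ext, fun h ↦ subsingleton_of_forall_eq 0 fun x ↦ ?_⟩
  obtain ⟨y, rfl⟩ := Ext.covariant_sequence_exact₁ A hS x (Ext.eq_zero_of_injective _) (zero_add 1)
  obtain ⟨a, rfl⟩ := (Ext.mk₀_bijective A S.X₃).2 y
  obtain ⟨b, rfl⟩ := h a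
  rw [← Ext.mk₀_comp_mk₀, Ext.comp_assoc_of_second_deg_zero, hS.comp_extClass, Ext.comp_zero]

end Lifting

lemma Adjunction.forall_exists_lift_iff {𝓐 : Type u} [Category.{v} 𝓐] {𝓑 : Type u'}
    [Category.{v'} 𝓑] {F : 𝓐 ⥤ 𝓑} {G : 𝓑 ⥤ 𝓐} (adj : F ⊣ G) (A : 𝓐) {Y Z : 𝓑} (g : Y ⟶ Z) :
    (∀ a : F.obj A ⟶ Z, ∃ b : F.obj A ⟶ Y, b ≫ g = a) ↔
      ∀ a : A ⟶ G.obj Z, ∃ b : A ⟶ G.obj Y, b ≫ G.map g = a := by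
  simp only [(adj.homEquiv A Y).symm.surjective.exists,
    (adj.homEquiv A Z).symm.surjective.forall, ← adj.homEquiv_naturality_right_symm,
    (adj.homEquiv A Z).symm.injective.eq_iff]

/-- A morphism is epi if every morphism to its target from a projective object in a class `𝓒`
lifts, provided that `𝓒` contains enough projectives to detect nonzero objects. -/
lemma epi_of_forall_exists_lift {𝓐 : Type u} [Category.{v} 𝓐] [Abelian 𝓐] {𝓒 : Set 𝓐}
    (h𝓒 : ∀ M : 𝓐, ¬ IsZero M → ∃ P : 𝓐, Projective P ∧ P ∈ 𝓒 ∧ ∃ f : P ⟶ M, f ≠ 0)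
    {Y Z : 𝓐} (g : Y ⟶ Z) (h : ∀ C ∈ 𝓒, ∀ a : C ⟶ Z, ∃ b : C ⟶ Y, b ≫ g = a) : Epi g := by
  refine Preadditive.epi_of_isZero_cokernel g (by_contra fun hM ↦ ?_)
  obtain ⟨P, _, hP, f, hf⟩ := h𝓒 _ hM
  obtain ⟨b, hb⟩ := h P hP (Projective.factorThru f (cokernel.π g))
  apply hf
  rw [← Projective.factorThru_comp f (cokernel.π g), ← hb, Category.assoc, cokernel.condition,
    comp_zero]

end CategoryTheory

theorem psi_rightPerp_eq
    {𝓜 : Type u} [Category.{v} 𝓜] [Abelian 𝓜]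
    [EnoughProjectives 𝓜] [EnoughInjectives 𝓜] [HasExt.{w} 𝓜]
    {𝓧 : Type u'} [Category.{v'} 𝓧] [Abelian 𝓧]
    [EnoughProjectives 𝓧] [EnoughInjectives 𝓧] [HasExt.{w'} 𝓧]
    {J : Type*} (Cf Kf : J → (𝓧 ⥤ 𝓜)) (Sf : J → (𝓜 ⥤ 𝓧))
    [∀ j, (Cf j).Additive] [∀ j, (Kf j).Additive]
    (adjCS : ∀ j, Cf j ⊣ Sf j) (adjSK : ∀ j, Sf j ⊣ Kf j)
    (𝓒 : Set 𝓜)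
    (h𝓒 : ∀ M : 𝓜, ¬ IsZero M → ∃ P : 𝓜, Projective P ∧ P ∈ 𝓒 ∧ ∃ f : P ⟶ M, f ≠ 0) :
    Psi Kf (rightPerp 𝓒) =
      {X : 𝓧 | ∀ (j : J), ∀ C ∈ 𝓒, Subsingleton (Ext ((Sf j).obj C) X 1)} := by
  ext X
  refine forall_congr' fun j ↦ ?_
  have := (adjCS j).rightAdjoint_preservesLimits
  have := (adjSK j).rightAdjoint_preservesLimits
  let I := injectiveResolution X
  have hI := I.shortExact_firstCosyzygy
  have : Injective I.firstCosyzygy.X₂ := I.injective 0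
  have : Injective (I.firstCosyzygy.map (Kf j)).X₂ := (adjSK j).map_injective _ (I.injective 0)
  have hK (h : Epi ((Kf j).map I.firstCosyzygy.g)) : (I.firstCosyzygy.map (Kf j)).ShortExact :=
    have := hI.mono_f
    { exact := hI.exact.map_of_mono_of_preservesKernel (Kf j) inferInstance inferInstance
      mono_f := inferInstanceAs (Mono ((Kf j).map _))
      epi_g := h }
  have hX : (∀ C ∈ 𝓒, Subsingleton (Ext ((Sf j).obj C) X 1)) ↔
      ∀ C ∈ 𝓒, ∀ a : C ⟶ (Kf j).obj I.firstCosyzygy.X₃,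
        ∃ b : C ⟶ (Kf j).obj I.firstCosyzygy.X₂, b ≫ (Kf j).map I.firstCosyzygy.g = a :=
    forall₂_congr fun C _ ↦ (hI.subsingleton_ext_iff _).trans
      ((adjSK j).forall_exists_lift_iff C I.firstCosyzygy.g)
  refine (and_congr_right' (I.isZero_rightDerived_one_obj_iff (Kf j))).trans (Iff.trans ?_ hX.symm)
  refine ⟨fun ⟨h₁, h₂⟩ C hC ↦ (hK h₂).exists_lift_of_subsingleton_ext (h₁ C hC), fun h ↦ ?_⟩
  have h₂ := epi_of_forall_exists_lift h𝓒 _ h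
  exact ⟨fun C hC ↦ ((hK h₂).subsingleton_ext_iff C).2 (h C hC), h₂⟩
end

section
/- In the abstract setup, let (𝓐, 𝓑) be a cotorsion pair in 𝓜. Then (Φ(𝓐), Φ(𝓐)^⊥) and (⊥Ψ(𝓑), Ψ(𝓑)) are cotorsion pairs in 𝓧; that is, ⊥(Φ(𝓐)^⊥) = Φ(𝓐) and (⊥Ψ(𝓑))^⊥ = Ψ(𝓑). -/
/-!
Statement 5 (Theorem 1.10): if `(𝓐, 𝓑)` is a cotorsion pair in `𝓜`, then `(Φ(𝓐), Φ(𝓐)^⊥)` and `(⊥Ψ(𝓑), Ψ(𝓑))` are cotorsion pairs in `𝓧`.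
(Holm–Jørgensen, "Model categories of quiver representations".)
-/

open CategoryTheory CategoryTheory.Limits CategoryTheory.Abelian

universe w w' v u v' u'

section PerpGalois

variable {𝓨 : Type u} [Category.{v} 𝓨] [Abelian 𝓨] [HasExt.{w} 𝓨]

lemma isCotorsionPair_leftPerp (Δ : Set 𝓨) :
    IsCotorsionPair (leftPerp Δ) (rightPerp (leftPerp Δ)) :=
  ⟨Set.Subset.antisymm (fun _ hX _ hY => hY _ hX)
    (fun _ hX D hD => hX D fun _ hC => hC D hD), rfl⟩

lemma isCotorsionPair_rightPerp (Γ : Set 𝓨) :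
    IsCotorsionPair (leftPerp (rightPerp Γ)) (rightPerp Γ) :=
  ⟨rfl, Set.Subset.antisymm (fun _ hX C hC => hX C fun _ hD => hD C hC)
    (fun _ hX _ hY => hY _ hX)⟩

end PerpGalois

section ExtOne

variable {𝓨 : Type u} [Category.{v} 𝓨] [Abelian 𝓨] [HasExt.{w} 𝓨]

/-- `Ext¹(X₃, Y)` vanishes iff every map `X₁ ⟶ Y` extends along a presentation
`0 ⟶ X₁ ⟶ X₂ ⟶ X₃ ⟶ 0` with `X₂` projective. -/
lemma subsingleton_ext_one_iff_extends {S : ShortComplex 𝓨} (hS : S.ShortExact)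
    [Projective S.X₂] (Y : 𝓨) :
    Subsingleton (Ext S.X₃ Y 1) ↔ ∀ f : S.X₁ ⟶ Y, ∃ g : S.X₂ ⟶ Y, S.f ≫ g = f := by
  constructor
  · intro _ f
    obtain ⟨x, hx⟩ := Ext.contravariant_sequence_exact₁ hS Y (Ext.mk₀ f) (add_zero 1)
      (Subsingleton.elim _ _)
    obtain ⟨g, rfl⟩ := Ext.addEquiv₀.symm.surjective x
    exact ⟨g, Ext.addEquiv₀.symm.injective (by simpa using hx)⟩
  · intro H
    refine subsingleton_of_forall_eq 0 fun x => ?_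
    obtain ⟨y, rfl⟩ := Ext.contravariant_sequence_exact₃ hS Y x
      (Ext.eq_zero_of_projective _) (add_zero 1)
    obtain ⟨f, rfl⟩ := Ext.addEquiv₀.symm.surjective y
    obtain ⟨g, rfl⟩ := H f
    have h₀ := hS.extClass_comp_assoc (Ext.mk₀ g) (h := add_zero 1)
    simpa using h₀

/-- `Ext¹(Y, X₁)` vanishes iff every map `Y ⟶ X₃` lifts along a copresentation
`0 ⟶ X₁ ⟶ X₂ ⟶ X₃ ⟶ 0` with `X₂` injective. -/
lemma subsingleton_ext_one_iff_lifts {S : ShortComplex 𝓨} (hS : S.ShortExact)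
    [Injective S.X₂] (Y : 𝓨) :
    Subsingleton (Ext Y S.X₁ 1) ↔ ∀ f : Y ⟶ S.X₃, ∃ g : Y ⟶ S.X₂, g ≫ S.g = f := by
  constructor
  · intro _ f
    obtain ⟨x, hx⟩ := Ext.covariant_sequence_exact₃ Y hS (Ext.mk₀ f) (zero_add 1)
      (Subsingleton.elim _ _)
    obtain ⟨g, rfl⟩ := Ext.addEquiv₀.symm.surjective x
    exact ⟨g, Ext.addEquiv₀.symm.injective (by simpa using hx)⟩
  · intro H
    refine subsingleton_of_forall_eq 0 fun x => ?_
    obtain ⟨y, rfl⟩ := Ext.covariant_sequence_exact₁ Y hS x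
      (Ext.eq_zero_of_injective _) (zero_add 1)
    obtain ⟨f, rfl⟩ := Ext.addEquiv₀.symm.surjective y
    obtain ⟨g, rfl⟩ := H f
    change (Ext.mk₀ _).comp _ _ = 0
    rw [← Ext.mk₀_comp_mk₀, Ext.comp_assoc_of_second_deg_zero, hS.comp_extClass, Ext.comp_zero]

end ExtOne

section Derived

variable {𝓜 : Type u} [Category.{v} 𝓜] [Abelian 𝓜]
  {𝓧 : Type u'} [Category.{v'} 𝓧] [Abelian 𝓧]

/-- A right exact functor is exact at the middle of `S` iff it keeps the map
`coker S.f ⟶ S.X₃` monic. -/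
lemma exact_map_iff_mono_map_cokernel_desc (F : 𝓧 ⥤ 𝓜) [F.PreservesZeroMorphisms]
    [PreservesFiniteColimits F] (S : ShortComplex 𝓧) :
    (S.map F).Exact ↔ Mono (F.map (cokernel.desc S.f S.g S.zero)) := by
  rw [ShortComplex.exact_iff_mono_cokernel_desc]
  change Mono (cokernel.desc (F.map S.f) (F.map S.g) (S.map F).zero) ↔ _
  have : F.map (cokernel.desc S.f S.g S.zero) = (PreservesCokernel.iso F S.f).hom ≫
      cokernel.desc (F.map S.f) (F.map S.g) (S.map F).zero := by
    rw [← cancel_epi (F.map (cokernel.π S.f)), PreservesCokernel.π_iso_hom_assoc,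
      ← F.map_comp, cokernel.π_desc]
    exact (cokernel.π_desc _ _ _).symm
  rw [this, mono_comp_iff_of_isIso]

/-- A left exact functor is exact at the middle of `S` iff it keeps the map
`S.X₁ ⟶ ker S.g` epic. -/
lemma exact_map_iff_epi_map_kernel_lift (F : 𝓧 ⥤ 𝓜) [F.PreservesZeroMorphisms]
    [PreservesFiniteLimits F] (S : ShortComplex 𝓧) :
    (S.map F).Exact ↔ Epi (F.map (kernel.lift S.g S.f S.zero)) := by
  rw [ShortComplex.exact_iff_epi_kernel_lift]
  change Epi (kernel.lift (F.map S.g) (F.map S.f) (S.map F).zero) ↔ _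
  have : F.map (kernel.lift S.g S.f S.zero) =
      kernel.lift (F.map S.g) (F.map S.f) (S.map F).zero ≫ (PreservesKernel.iso F S.g).inv := by
    rw [← cancel_mono (F.map (kernel.ι S.g)), Category.assoc, PreservesKernel.iso_inv_ι,
      ← F.map_comp, kernel.lift_ι]
    exact (kernel.lift_ι _ _ _).symm
  rw [this, epi_comp_iff_of_isIso]

/-- Every object has a projective presentation whose first syzygy computes the vanishing
of the first left derived functor of every right exact functor. -/
lemma exists_projective_presentation [EnoughProjectives 𝓧] (X : 𝓧) :
    ∃ (K P : 𝓧) (k : K ⟶ P) (p : P ⟶ X) (w : k ≫ p = 0),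
      (ShortComplex.mk k p w).ShortExact ∧ Projective P ∧
      ∀ (F : 𝓧 ⥤ 𝓜) [F.Additive] [PreservesFiniteColimits F],
        IsZero ((F.leftDerived 1).obj X) ↔ Mono (F.map k) := by
  let R := projectiveResolution X
  let S := ShortComplex.mk _ _ (R.complex.d_comp_d 2 1 0)
  have w : cokernel.desc S.f S.g S.zero ≫ R.π.f 0 = 0 := by
    rw [← cancel_epi (cokernel.π S.f), cokernel.π_desc_assoc, comp_zero]
    exact R.complex_d_comp_π_f_zero
  refine ⟨_, R.complex.X 0, cokernel.desc S.f S.g S.zero, R.π.f 0, w, ?_, inferInstance, ?_⟩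
  · have hex : (ShortComplex.mk _ _ R.complex_d_comp_π_f_zero).Exact :=
      ShortComplex.exact_of_g_is_cokernel _ R.isColimitCokernelCofork
    let φ : ShortComplex.mk _ _ R.complex_d_comp_π_f_zero ⟶ ShortComplex.mk _ _ w :=
      { τ₁ := cokernel.π S.f
        τ₂ := 𝟙 _
        τ₃ := 𝟙 _
        comm₁₂ := by simp [S]
        comm₂₃ := (Category.id_comp _).trans (Category.comp_id _).symm }
    have : Epi φ.τ₁ := inferInstanceAs (Epi (cokernel.π S.f))
    have : IsIso φ.τ₂ := inferInstanceAs (IsIso (𝟙 _))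
    have : Mono φ.τ₃ := inferInstanceAs (Mono (𝟙 _))
    exact
      { exact := (ShortComplex.exact_iff_of_epi_of_isIso_of_mono φ).1 hex
        mono_f := (ShortComplex.exact_iff_mono_cokernel_desc _).1 (R.exact_succ 0)
        epi_g := inferInstanceAs (Epi (R.π.f 0)) }
  · intro F _ _
    rw [← exact_map_iff_mono_map_cokernel_desc, (R.isoLeftDerivedObj F 1).isZero_iff]
    exact (HomologicalComplex.exactAt_iff_isZero_homology _ _).symm.trans
      (HomologicalComplex.exactAt_iff' _ 2 1 0 (by simp) (by simp))

/-- Every object has an injective copresentation whose first cosyzygy computes the vanishing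
of the first right derived functor of every left exact functor. -/
lemma exists_injective_copresentation [EnoughInjectives 𝓧] (X : 𝓧) :
    ∃ (I Q : 𝓧) (i : X ⟶ I) (q : I ⟶ Q) (w : i ≫ q = 0),
      (ShortComplex.mk i q w).ShortExact ∧ Injective I ∧
      ∀ (F : 𝓧 ⥤ 𝓜) [F.Additive] [PreservesFiniteLimits F],
        IsZero ((F.rightDerived 1).obj X) ↔ Epi (F.map q) := by
  let R := injectiveResolution X
  let S := ShortComplex.mk _ _ (R.cocomplex.d_comp_d 0 1 2)
  have w : R.ι.f 0 ≫ kernel.lift S.g S.f S.zero = 0 := by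
    rw [← cancel_mono (kernel.ι S.g), Category.assoc, kernel.lift_ι, zero_comp]
    exact R.ι_f_zero_comp_complex_d
  refine ⟨R.cocomplex.X 0, _, R.ι.f 0, kernel.lift S.g S.f S.zero, w, ?_, inferInstance, ?_⟩
  · have hex : (ShortComplex.mk _ _ R.ι_f_zero_comp_complex_d).Exact :=
      ShortComplex.exact_of_f_is_kernel _ R.isLimitKernelFork
    let φ : ShortComplex.mk _ _ w ⟶ ShortComplex.mk _ _ R.ι_f_zero_comp_complex_d :=
      { τ₁ := 𝟙 _
        τ₂ := 𝟙 _
        τ₃ := kernel.ι S.g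
        comm₁₂ := (Category.id_comp _).trans (Category.comp_id _).symm
        comm₂₃ := by simp [S] }
    have : Epi φ.τ₁ := inferInstanceAs (Epi (𝟙 _))
    have : IsIso φ.τ₂ := inferInstanceAs (IsIso (𝟙 _))
    have : Mono φ.τ₃ := inferInstanceAs (Mono (kernel.ι S.g))
    exact
      { exact := (ShortComplex.exact_iff_of_epi_of_isIso_of_mono φ).2 hex
        mono_f := inferInstanceAs (Mono (R.ι.f 0))
        epi_g := (ShortComplex.exact_iff_epi_kernel_lift _).1 (R.exact_succ 0) }
  · intro F _ _
    rw [← exact_map_iff_epi_map_kernel_lift, (R.isoRightDerivedObj F 1).isZero_iff]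
    exact (HomologicalComplex.exactAt_iff_isZero_homology _ _).symm.trans
      (HomologicalComplex.exactAt_iff' _ 0 1 2 (by simp) (by simp))

end Derived

section Adjunction

variable {𝓜 : Type u} [Category.{v} 𝓜] [Abelian 𝓜] [HasExt.{w} 𝓜]
  {𝓧 : Type u'} [Category.{v'} 𝓧] [Abelian 𝓧] [HasExt.{w'} 𝓧]

lemma mem_leftPerp_iff_of_adjunction [EnoughInjectives 𝓜] [EnoughProjectives 𝓧]
    {C : 𝓧 ⥤ 𝓜} {S : 𝓜 ⥤ 𝓧} [C.Additive] (adj : C ⊣ S) [S.PreservesEpimorphisms]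
    {𝓑 : Set 𝓜} (h𝓑 : ∀ I : 𝓜, Injective I → I ∈ 𝓑) (X : 𝓧) :
    (∀ B ∈ 𝓑, Subsingleton (Ext X (S.obj B) 1)) ↔
      C.obj X ∈ leftPerp 𝓑 ∧ IsZero ((C.leftDerived 1).obj X) := by
  have := adj.leftAdjoint_preservesColimits
  obtain ⟨K, P, k, p, w, hS, hP, hC⟩ := exists_projective_presentation (𝓜 := 𝓜) X
  have hExt (B : 𝓜) : Subsingleton (Ext X (S.obj B) 1) ↔
      ∀ f : C.obj K ⟶ B, ∃ g : C.obj P ⟶ B, C.map k ≫ g = f := by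
    refine (subsingleton_ext_one_iff_extends hS (S.obj B)).trans
      ((adj.homEquiv K B).symm.forall_congr fun f => ?_)
    refine (adj.homEquiv P B).symm.exists_congr fun g => ?_
    rw [← (adj.homEquiv K B).symm.apply_eq_iff_eq, adj.homEquiv_naturality_left_symm]
  have hP' : Projective (C.obj P) := adj.map_projective P hP
  have hMono (hk : Mono (C.map k)) :
      ((ShortComplex.mk k p w).map C).ShortExact :=
    have := hS.epi_g
    { exact := hS.exact.map_of_epi_of_preservesCokernel C hS.epi_g inferInstance
      mono_f := hk
      epi_g := inferInstanceAs (Epi (C.map p)) }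
  rw [hC C]
  constructor
  · intro H
    have hk : Mono (C.map k) := by
      obtain ⟨g, hg⟩ := (hExt _).1 (H _ (h𝓑 _ inferInstance)) (Injective.ι (C.obj K))
      exact mono_of_mono_fac hg
    have : Projective ((ShortComplex.mk k p w).map C).X₂ := hP'
    exact ⟨fun B hB => (subsingleton_ext_one_iff_extends (hMono hk) B).2
      ((hExt B).1 (H B hB)), hk⟩
  · rintro ⟨hX, hk⟩ B hB
    have : Projective ((ShortComplex.mk k p w).map C).X₂ := hP'
    exact (hExt B).2 ((subsingleton_ext_one_iff_extends (hMono hk) B).1 (hX B hB))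

lemma mem_rightPerp_iff_of_adjunction [EnoughProjectives 𝓜] [EnoughInjectives 𝓧]
    {K : 𝓧 ⥤ 𝓜} {S : 𝓜 ⥤ 𝓧} [K.Additive] (adj : S ⊣ K) [S.PreservesMonomorphisms]
    {𝓐 : Set 𝓜} (h𝓐 : ∀ P : 𝓜, Projective P → P ∈ 𝓐) (X : 𝓧) :
    (∀ A ∈ 𝓐, Subsingleton (Ext (S.obj A) X 1)) ↔
      K.obj X ∈ rightPerp 𝓐 ∧ IsZero ((K.rightDerived 1).obj X) := by
  have := adj.rightAdjoint_preservesLimits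
  obtain ⟨I, Q, i, q, w, hS, hI, hK⟩ := exists_injective_copresentation (𝓜 := 𝓜) X
  have hExt (A : 𝓜) : Subsingleton (Ext (S.obj A) X 1) ↔
      ∀ f : A ⟶ K.obj Q, ∃ g : A ⟶ K.obj I, g ≫ K.map q = f := by
    refine (subsingleton_ext_one_iff_lifts hS (S.obj A)).trans
      ((adj.homEquiv A Q).forall_congr fun f => ?_)
    refine (adj.homEquiv A I).exists_congr fun g => ?_
    rw [← (adj.homEquiv A Q).apply_eq_iff_eq, adj.homEquiv_naturality_right]
  have hI' : Injective (K.obj I) := adj.map_injective I hI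
  have hEpi (hq : Epi (K.map q)) :
      ((ShortComplex.mk i q w).map K).ShortExact :=
    have := hS.mono_f
    { exact := hS.exact.map_of_mono_of_preservesKernel K hS.mono_f inferInstance
      mono_f := inferInstanceAs (Mono (K.map i))
      epi_g := hq }
  rw [hK K]
  constructor
  · intro H
    have hq : Epi (K.map q) := by
      obtain ⟨g, hg⟩ := (hExt _).1 (H _ (h𝓐 _ inferInstance)) (Projective.π (K.obj Q))
      exact epi_of_epi_fac hg
    have : Injective ((ShortComplex.mk i q w).map K).X₂ := hI'
    exact ⟨fun A hA => (subsingleton_ext_one_iff_lifts (hEpi hq) A).2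
      ((hExt A).1 (H A hA)), hq⟩
  · rintro ⟨hX, hq⟩ A hA
    have : Injective ((ShortComplex.mk i q w).map K).X₂ := hI'
    exact (hExt A).2 ((subsingleton_ext_one_iff_lifts (hEpi hq) A).1 (hX A hA))

end Adjunction

theorem phi_psi_cotorsionPairs
    {𝓜 : Type u} [Category.{v} 𝓜] [Abelian 𝓜]
    [EnoughProjectives 𝓜] [EnoughInjectives 𝓜] [HasExt.{w} 𝓜]
    {𝓧 : Type u'} [Category.{v'} 𝓧] [Abelian 𝓧]
    [EnoughProjectives 𝓧] [EnoughInjectives 𝓧] [HasExt.{w'} 𝓧]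
    {J : Type*} (Cf Kf : J → (𝓧 ⥤ 𝓜)) (Sf : J → (𝓜 ⥤ 𝓧))
    [∀ j, (Cf j).Additive] [∀ j, (Kf j).Additive]
    (adjCS : ∀ j, Cf j ⊣ Sf j) (adjSK : ∀ j, Sf j ⊣ Kf j)
    (𝓐 𝓑 : Set 𝓜) (h : IsCotorsionPair 𝓐 𝓑) :
    IsCotorsionPair (Phi Cf 𝓐) (rightPerp (Phi Cf 𝓐)) ∧
    IsCotorsionPair (leftPerp (Psi Kf 𝓑)) (Psi Kf 𝓑) := by
  obtain ⟨hA, hB⟩ := h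
  have hSepi (j : J) : (Sf j).PreservesEpimorphisms :=
    Functor.preservesEpimorphisms_of_adjunction (adjSK j)
  have hSmono (j : J) : (Sf j).PreservesMonomorphisms :=
    Functor.preservesMonomorphisms_of_adjunction (adjCS j)
  have hinj (I : 𝓜) (_ : Injective I) : I ∈ 𝓑 := by
    rw [← hB]
    exact fun _ _ => subsingleton_of_forall_eq 0 Ext.eq_zero_of_injective
  have hproj (P : 𝓜) (_ : Projective P) : P ∈ 𝓐 := by
    rw [hA]
    exact fun _ _ => subsingleton_of_forall_eq 0 Ext.eq_zero_of_projective
  have hPhi : Phi Cf 𝓐 = leftPerp {Y | ∃ j, ∃ B ∈ 𝓑, (Sf j).obj B = Y} := by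
    ext X
    have key (j : J) := mem_leftPerp_iff_of_adjunction (adjCS j) hinj X
    rw [← hA] at key
    refine (forall_congr' fun j => (key j).symm).trans ⟨?_, fun H j B hB' => H _ ⟨j, B, hB', rfl⟩⟩
    rintro H _ ⟨j, B, hB', rfl⟩
    exact H j B hB'
  have hPsi : Psi Kf 𝓑 = rightPerp {Y | ∃ j, ∃ A ∈ 𝓐, (Sf j).obj A = Y} := by
    ext X
    have key (j : J) := mem_rightPerp_iff_of_adjunction (adjSK j) hproj X
    rw [hB] at key
    refine (forall_congr' fun j => (key j).symm).trans ⟨?_, fun H j A hA' => H _ ⟨j, A, hA', rfl⟩⟩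
    rintro H _ ⟨j, A, hA', rfl⟩
    exact H j A hA'
  rw [hPhi, hPsi]
  exact ⟨isCotorsionPair_leftPerp _, isCotorsionPair_rightPerp _⟩
end

section
/- In the abstract setup, let (𝓐, 𝓑) be a hereditary cotorsion pair in 𝓜, and assume that R²K_j(X) = 0 for every j ∈ J and every X ∈ 𝓔_R. Then (⊥Ψ(𝓑), Ψ(𝓑)) is a hereditary cotorsion pair in 𝓧; in particular ⊥Ψ(𝓑) is closed under kernels of epimorphisms and Ψ(𝓑) is closed under cokernels of monomorphisms. -/
/-!
Statement 7 (Theorem 1.11(ii)): if `(𝓐, 𝓑)` is a hereditary cotorsion pair in `𝓜` and `R²K_j` vanishes on `𝓔_R`, then `(⊥Ψ(𝓑), Ψ(𝓑))` is a hereditary cotorsion pair in `𝓧`.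
(Holm–Jørgensen, "Model categories of quiver representations".)
-/

open CategoryTheory CategoryTheory.Limits CategoryTheory.Abelian

universe w w' v u v' u'

namespace CategoryTheory

lemma ShortComplex.exact_iff_projective_lift {C : Type u} [Category.{v} C] [Abelian C]
    [EnoughProjectives C] (S : ShortComplex C) :
    S.Exact ↔ ∀ (P : C) [Projective P] (x₂ : P ⟶ S.X₂), x₂ ≫ S.g = 0 →
      ∃ x₁ : P ⟶ S.X₁, x₁ ≫ S.f = x₂ := by
  constructor
  · intro hS P _ x₂ hx₂
    exact ⟨hS.liftFromProjective x₂ hx₂, hS.liftFromProjective_comp x₂ hx₂⟩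
  · intro hS
    rw [S.exact_iff_exact_up_to_refinements]
    intro A x₂ hx₂
    obtain ⟨x₁, hx₁⟩ := hS (Projective.over A) (Projective.π A ≫ x₂) (by simp [hx₂])
    exact ⟨_, Projective.π A, inferInstance, x₁, hx₁.symm⟩

/-- `Ext X Y (n + 1)` vanishes iff every cocycle of degree `n + 1` with values in an injective
resolution of `Y` is a coboundary. -/
lemma InjectiveResolution.subsingleton_ext_succ_iff {C : Type u} [Category.{v} C] [Abelian C]
    [HasExt.{w} C] {X Y : C} (R : InjectiveResolution Y) (n : ℕ) :
    Subsingleton (Ext X Y (n + 1)) ↔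
      ∀ f : X ⟶ R.cocomplex.X (n + 1), f ≫ R.cocomplex.d (n + 1) (n + 2) = 0 →
        ∃ g : X ⟶ R.cocomplex.X n, g ≫ R.cocomplex.d n (n + 1) = f := by
  constructor
  · intro hX f hf
    exact (R.extMk_eq_zero_iff f (n + 2) rfl hf n rfl).1 (Subsingleton.elim _ _)
  · intro hX
    refine subsingleton_of_forall_eq 0 fun α ↦ ?_
    obtain ⟨f, hf, rfl⟩ := R.extMk_surjective α (n + 2) rfl
    exact (R.extMk_eq_zero_iff f (n + 2) rfl hf n rfl).2 (hX f hf)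

/-- The right derived functors of a right adjoint `G` are detected by `Ext` groups out of
the images under the left adjoint of projective objects. -/
lemma Adjunction.isZero_rightDerived_succ_obj_iff
    {C : Type u} [Category.{v} C] [Abelian C] [EnoughProjectives C]
    {D : Type u'} [Category.{v'} D] [Abelian D] [EnoughInjectives D] [HasExt.{w'} D]
    {F : C ⥤ D} {G : D ⥤ C} [G.Additive] (adj : F ⊣ G) (n : ℕ) (X : D) :
    IsZero ((G.rightDerived (n + 1)).obj X) ↔
      ∀ (P : C) [Projective P], Subsingleton (Ext (F.obj P) X (n + 1)) := by
  have := adj.left_adjoint_additive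
  let R := injectiveResolution X
  rw [(R.isoRightDerivedObj G (n + 1)).isZero_iff]
  refine (HomologicalComplex.exactAt_iff_isZero_homology _ _).symm.trans ?_
  rw [HomologicalComplex.exactAt_iff' _ n (n + 1) (n + 2) (by simp) (by simp),
    ShortComplex.exact_iff_projective_lift]
  refine forall_congr' fun P ↦ forall_congr' fun _ ↦ ?_
  rw [R.subsingleton_ext_succ_iff]
  change (∀ f : P ⟶ G.obj (R.cocomplex.X (n + 1)),
    f ≫ G.map (R.cocomplex.d (n + 1) (n + 2)) = 0 →
      ∃ g : P ⟶ G.obj (R.cocomplex.X n), g ≫ G.map (R.cocomplex.d n (n + 1)) = f) ↔ _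
  constructor
  · intro hP f hf
    obtain ⟨g, hg⟩ := hP (adj.homEquiv _ _ f) (by
      rw [← adj.homEquiv_naturality_right, hf]
      simp [Adjunction.homEquiv_unit])
    refine ⟨(adj.homEquiv _ _).symm g, ?_⟩
    rw [← adj.homEquiv_naturality_right_symm, Equiv.symm_apply_eq, hg]
  · intro hP f hf
    obtain ⟨g, hg⟩ := hP ((adj.homEquiv _ _).symm f) (by
      rw [← adj.homEquiv_naturality_right_symm, hf]
      simp [Adjunction.homEquiv_counit])
    refine ⟨adj.homEquiv _ _ g, ?_⟩
    rw [← adj.homEquiv_naturality_right, hg, Equiv.apply_symm_apply]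

lemma shortExact_kernel_of_epi {C : Type u} [Category.{v} C] [Abelian C]
    {X Y : C} (f : X ⟶ Y) [Epi f] :
    (ShortComplex.mk (kernel.ι f) f (kernel.condition f)).ShortExact :=
  { exact := ShortComplex.exact_kernel f }

lemma shortExact_cokernel_of_mono {C : Type u} [Category.{v} C] [Abelian C]
    {X Y : C} (f : X ⟶ Y) [Mono f] :
    (ShortComplex.mk f (cokernel.π f) (cokernel.condition f)).ShortExact :=
  { exact := ShortComplex.exact_cokernel f }

namespace ShortComplex.ShortExact

variable {C : Type u} [Category.{v} C] [Abelian C] [HasExt.{w} C] {S : ShortComplex C}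

lemma subsingleton_ext_one_X₃_iff (hS : S.ShortExact) (Y : C)
    (h₂ : Subsingleton (Ext S.X₂ Y 1)) :
    Subsingleton (Ext S.X₃ Y 1) ↔ ∀ u : S.X₁ ⟶ Y, ∃ v : S.X₂ ⟶ Y, S.f ≫ v = u := by
  constructor
  · intro h₃ u
    obtain ⟨v, hv⟩ := Ext.contravariant_sequence_exact₁ hS Y (Ext.mk₀ u) (add_zero 1)
      (Subsingleton.elim _ _)
    obtain ⟨v, rfl⟩ := (Ext.mk₀_bijective _ _).2 v
    exact ⟨v, (Ext.mk₀_bijective _ _).1 (by rwa [Ext.mk₀_comp_mk₀] at hv)⟩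
  · intro hu
    refine subsingleton_of_forall_eq 0 fun x ↦ ?_
    obtain ⟨u, rfl⟩ := Ext.contravariant_sequence_exact₃ hS Y x (Subsingleton.elim _ _)
      (add_zero 1)
    obtain ⟨u, rfl⟩ := (Ext.mk₀_bijective _ _).2 u
    obtain ⟨v, rfl⟩ := hu u
    rw [← Ext.mk₀_comp_mk₀, hS.extClass_comp_assoc]

lemma subsingleton_ext_X₁ (hS : S.ShortExact) (Y : C) {n : ℕ}
    (h₂ : Subsingleton (Ext S.X₂ Y n)) (h₃ : Subsingleton (Ext S.X₃ Y (1 + n))) :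
    Subsingleton (Ext S.X₁ Y n) := by
  refine subsingleton_of_forall_eq 0 fun x ↦ ?_
  obtain ⟨y, rfl⟩ := Ext.contravariant_sequence_exact₁ hS Y x rfl (Subsingleton.elim _ _)
  rw [Subsingleton.elim y 0, Ext.comp_zero]

lemma subsingleton_ext_X₃ (hS : S.ShortExact) (Y : C) {n : ℕ}
    (h₁ : Subsingleton (Ext S.X₁ Y n)) (h₂ : Subsingleton (Ext S.X₂ Y (1 + n))) :
    Subsingleton (Ext S.X₃ Y (1 + n)) := by
  refine subsingleton_of_forall_eq 0 fun x ↦ ?_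
  obtain ⟨y, rfl⟩ := Ext.contravariant_sequence_exact₃ hS Y x (Subsingleton.elim _ _) rfl
  rw [Subsingleton.elim y 0, Ext.comp_zero]

lemma subsingleton_ext_covariant_X₁ (hS : S.ShortExact) (X : C) {n : ℕ}
    (h₂ : Subsingleton (Ext X S.X₂ (n + 1))) (h₃ : Subsingleton (Ext X S.X₃ n)) :
    Subsingleton (Ext X S.X₁ (n + 1)) := by
  refine subsingleton_of_forall_eq 0 fun x ↦ ?_
  obtain ⟨y, rfl⟩ := Ext.covariant_sequence_exact₁ X hS x (Subsingleton.elim _ _) rfl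
  rw [Subsingleton.elim y 0, Ext.zero_comp]

lemma subsingleton_ext_covariant_X₃ (hS : S.ShortExact) (X : C) {n : ℕ}
    (h₁ : Subsingleton (Ext X S.X₁ (n + 1))) (h₂ : Subsingleton (Ext X S.X₂ n)) :
    Subsingleton (Ext X S.X₃ n) := by
  refine subsingleton_of_forall_eq 0 fun x ↦ ?_
  obtain ⟨y, rfl⟩ := Ext.covariant_sequence_exact₃ X hS x rfl (Subsingleton.elim _ _)
  rw [Subsingleton.elim y 0, Ext.zero_comp]

end ShortComplex.ShortExact

/-- If `F ⊣ G`, and `0 ⟶ S.X₁ ⟶ S.X₂ ⟶ S.X₃ ⟶ 0` stays exact after applying `F`, with both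
`Ext¹(S.X₂, G X)` and `Ext¹(F S.X₂, X)` zero, then `Ext¹(F S.X₃, X)` and `Ext¹(S.X₃, G X)`
vanish simultaneously. -/
lemma Adjunction.subsingleton_ext_one_X₃_iff
    {C : Type u} [Category.{v} C] [Abelian C] [HasExt.{w} C]
    {D : Type u'} [Category.{v'} D] [Abelian D] [HasExt.{w'} D]
    {F : C ⥤ D} {G : D ⥤ C} [F.PreservesZeroMorphisms] (adj : F ⊣ G) {S : ShortComplex C}
    (hS : S.ShortExact) (hFS : (S.map F).ShortExact) (X : D)
    (h₂ : Subsingleton (Ext S.X₂ (G.obj X) 1)) (hF₂ : Subsingleton (Ext (F.obj S.X₂) X 1)) :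
    Subsingleton (Ext (F.obj S.X₃) X 1) ↔ Subsingleton (Ext S.X₃ (G.obj X) 1) := by
  rw [hS.subsingleton_ext_one_X₃_iff _ h₂]
  refine (hFS.subsingleton_ext_one_X₃_iff X hF₂).trans ?_
  change (∀ u : F.obj S.X₁ ⟶ X, ∃ v : F.obj S.X₂ ⟶ X, F.map S.f ≫ v = u) ↔ _
  constructor
  · intro hu u
    obtain ⟨v, hv⟩ := hu ((adj.homEquiv _ _).symm u)
    refine ⟨adj.homEquiv _ _ v, ?_⟩
    rw [← adj.homEquiv_naturality_left, ← Equiv.eq_symm_apply, hv]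
  · intro hu u
    obtain ⟨v, hv⟩ := hu (adj.homEquiv _ _ u)
    refine ⟨(adj.homEquiv _ _).symm v, ?_⟩
    rw [← adj.homEquiv_naturality_left_symm, hv, Equiv.symm_apply_apply]

end CategoryTheory

section CotorsionPairs

variable {C : Type u} [Category.{v} C] [Abelian C] [HasExt.{w} C]

lemma isCotorsionPair_leftPerp_rightPerp (Γ : Set C) :
    IsCotorsionPair (leftPerp (rightPerp Γ)) (rightPerp Γ) :=
  ⟨rfl, Set.Subset.antisymm (fun _ hY X hX ↦ hY X fun _ hD ↦ hD X hX)
    fun Y hY _ hX ↦ hX Y hY⟩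

lemma mem_leftPerp_of_projective (Δ : Set C) (P : C) [Projective P] : P ∈ leftPerp Δ :=
  fun D _ ↦ Ext.subsingleton_of_projective P D 0

lemma mem_rightPerp_of_injective (Γ : Set C) (I : C) [Injective I] : I ∈ rightPerp Γ :=
  fun X _ ↦ Ext.subsingleton_of_injective X I 0

/-- With enough injectives, the left class of a cotorsion pair whose right class is closed under
cokernels of monomorphisms is closed under kernels of epimorphisms. -/
lemma closedUnderKernelsOfEpis_leftPerp_rightPerp [EnoughInjectives C] (Γ : Set C)
    (hΓ : ClosedUnderCokernelsOfMonos (rightPerp Γ)) :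
    ClosedUnderKernelsOfEpis (leftPerp (rightPerp Γ)) := by
  intro X Y f _ hX hY D hD
  refine (shortExact_kernel_of_epi f).subsingleton_ext_X₁ D (hX D hD) ?_
  exact (shortExact_cokernel_of_mono (Injective.ι D)).subsingleton_ext_covariant_X₁ Y
    (Ext.subsingleton_of_injective _ _ _)
    (hY _ (hΓ _ inferInstance hD (mem_rightPerp_of_injective Γ _)))

end CotorsionPairs

section Adjunctions

variable {𝓜 : Type u} [Category.{v} 𝓜] [Abelian 𝓜] [EnoughProjectives 𝓜] [HasExt.{w} 𝓜]
  {𝓧 : Type u'} [Category.{v'} 𝓧] [Abelian 𝓧] [HasExt.{w'} 𝓧] [EnoughInjectives 𝓧]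

/-- The class `Ψ(𝓐^⊥)` is the right orthogonal of the objects `S_j A` with `A ∈ 𝓐`. -/
lemma psi_rightPerp_eq_s7 {J : Type*} {Kf : J → (𝓧 ⥤ 𝓜)} {Sf : J → (𝓜 ⥤ 𝓧)}
    [∀ j, (Kf j).Additive] [∀ j, (Sf j).Additive] [∀ j, PreservesFiniteLimits (Sf j)]
    (adjSK : ∀ j, Sf j ⊣ Kf j) (𝓐 : Set 𝓜) (hproj : ∀ (P : 𝓜) [Projective P], P ∈ 𝓐) :
    Psi Kf (rightPerp 𝓐) = rightPerp {X | ∃ j, ∃ A ∈ 𝓐, X = (Sf j).obj A} := by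
  have key (j : J) (X : 𝓧) (hX : IsZero (((Kf j).rightDerived 1).obj X)) (A : 𝓜) :
      Subsingleton (Ext ((Sf j).obj A) X 1) ↔ Subsingleton (Ext A ((Kf j).obj X) 1) := by
    have := (adjSK j).leftAdjoint_preservesColimits
    have hS := shortExact_kernel_of_epi (Projective.π A)
    exact (adjSK j).subsingleton_ext_one_X₃_iff hS (hS.map_of_exact (Sf j)) X
      (Ext.subsingleton_of_projective _ _ _)
      (((adjSK j).isZero_rightDerived_succ_obj_iff 0 X).1 hX _)
  ext X
  constructor
  · rintro hX _ ⟨j, A, hA, rfl⟩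
    exact (key j X (hX j).2 A).2 ((hX j).1 A hA)
  · intro hX j
    have hR : IsZero (((Kf j).rightDerived 1).obj X) :=
      ((adjSK j).isZero_rightDerived_succ_obj_iff 0 X).2 fun P _ ↦ hX _ ⟨j, P, hproj P, rfl⟩
    exact ⟨fun A hA ↦ (key j X hR A).1 (hX _ ⟨j, A, hA, rfl⟩), hR⟩

end Adjunctions

theorem psi_hereditary_cotorsionPair
    {𝓜 : Type u} [Category.{v} 𝓜] [Abelian 𝓜]
    [EnoughProjectives 𝓜] [EnoughInjectives 𝓜] [HasExt.{w} 𝓜]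
    {𝓧 : Type u'} [Category.{v'} 𝓧] [Abelian 𝓧]
    [EnoughProjectives 𝓧] [EnoughInjectives 𝓧] [HasExt.{w'} 𝓧]
    {J : Type*} (Cf Kf : J → (𝓧 ⥤ 𝓜)) (Sf : J → (𝓜 ⥤ 𝓧))
    [∀ j, (Cf j).Additive] [∀ j, (Kf j).Additive]
    (adjCS : ∀ j, Cf j ⊣ Sf j) (adjSK : ∀ j, Sf j ⊣ Kf j)
    (𝓐 𝓑 : Set 𝓜) (h : IsCotorsionPair 𝓐 𝓑) (hher : IsHereditary 𝓐 𝓑)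
    (hR2 : ∀ (j : J), ∀ X ∈ ER Kf, IsZero (((Kf j).rightDerived 2).obj X)) :
    IsCotorsionPair (leftPerp (Psi Kf 𝓑)) (Psi Kf 𝓑) ∧
    IsHereditary (leftPerp (Psi Kf 𝓑)) (Psi Kf 𝓑) := by
  obtain ⟨h𝓐, rfl⟩ := h
  have hproj (P : 𝓜) [Projective P] : P ∈ 𝓐 := h𝓐 ▸ mem_leftPerp_of_projective _ P
  have (j : J) : PreservesLimitsOfSize.{0, 0} (Sf j) := (adjCS j).rightAdjoint_preservesLimits
  have (j : J) : PreservesColimitsOfSize.{0, 0} (Sf j) := (adjSK j).leftAdjoint_preservesColimits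
  have (j : J) : (Sf j).Additive := (adjSK j).left_adjoint_additive
  have hΨ := psi_rightPerp_eq_s7 adjSK 𝓐 hproj
  have hcoker : ClosedUnderCokernelsOfMonos (Psi Kf (rightPerp 𝓐)) := by
    intro X Y f _ hX hY
    have hX' := hX
    rw [hΨ] at hX' hY ⊢
    rintro _ ⟨j, A, hA, rfl⟩
    refine (shortExact_cokernel_of_mono f).subsingleton_ext_covariant_X₃ _ ?_
      (hY _ ⟨j, A, hA, rfl⟩)
    refine ((shortExact_kernel_of_epi (Projective.π A)).map_of_exact
      (Sf j)).subsingleton_ext_X₃ X (n := 1) ?_ ?_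
    · exact hX' _ ⟨j, _, hher.1 (Projective.π A) inferInstance (hproj _) hA, rfl⟩
    · exact ((adjSK j).isZero_rightDerived_succ_obj_iff 1 X).1
        (hR2 j X fun i ↦ (hX i).2) _
  refine ⟨hΨ ▸ isCotorsionPair_leftPerp_rightPerp _, ?_, hcoker⟩
  rw [hΨ] at hcoker ⊢
  exact closedUnderKernelsOfEpis_leftPerp_rightPerp _ hcoker
end

section
/- In the abstract setup, let (𝓐, 𝓑) be a cotorsion pair in 𝓜, and assume conditions (Comp1), (Ex) and (Seq) hold. Then the cotorsion pairs (Φ(𝓐), Φ(𝓐)^⊥) and (⊥Ψ(𝓑), Ψ(𝓑)) in 𝓧 are compatible; in particular Φ(𝓐) ∩ Φ(𝓐)^⊥ = ⊥Ψ(𝓑) ∩ Ψ(𝓑). -/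
/-!
Statement 8 (Theorem 1.14): under conditions (Comp1), (Ex) and (Seq), the cotorsion pairs `(Φ(𝓐), Φ(𝓐)^⊥)` and `(⊥Ψ(𝓑), Ψ(𝓑))` in `𝓧` are compatible.
(Holm–Jørgensen, "Model categories of quiver representations".)
-/

open CategoryTheory CategoryTheory.Limits CategoryTheory.Abelian

universe w w' v u v' u'

namespace CategoryTheory.Abelian.Ext

section

variable {𝓨 : Type u} [Category.{v} 𝓨] [Abelian 𝓨] [HasExt.{w} 𝓨] {S : ShortComplex 𝓨}

lemma exists_extension_of_subsingleton (hS : S.ShortExact) {Y : 𝓨}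
    (h : Subsingleton (Ext S.X₃ Y 1)) (f : S.X₁ ⟶ Y) : ∃ g : S.X₂ ⟶ Y, S.f ≫ g = f := by
  obtain ⟨y, hy⟩ := contravariant_sequence_exact₁ hS Y (mk₀ f) (add_zero 1)
    (Subsingleton.elim _ _)
  obtain ⟨g, rfl⟩ := (mk₀_bijective _ _).surjective y
  rw [mk₀_comp_mk₀] at hy
  exact ⟨g, (mk₀_bijective _ _).injective hy⟩

lemma exists_lift_of_subsingleton (hS : S.ShortExact) {X : 𝓨}
    (h : Subsingleton (Ext X S.X₁ 1)) (f : X ⟶ S.X₃) : ∃ g : X ⟶ S.X₂, g ≫ S.g = f := by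
  obtain ⟨y, hy⟩ := covariant_sequence_exact₃ X hS (mk₀ f) (zero_add 1)
    (Subsingleton.elim _ _)
  obtain ⟨g, rfl⟩ := (mk₀_bijective _ _).surjective y
  rw [mk₀_comp_mk₀] at hy
  exact ⟨g, (mk₀_bijective _ _).injective hy⟩

lemma subsingleton_of_exists_extension (hS : S.ShortExact) [Projective S.X₂] {Y : 𝓨}
    (h : ∀ f : S.X₁ ⟶ Y, ∃ g : S.X₂ ⟶ Y, S.f ≫ g = f) : Subsingleton (Ext S.X₃ Y 1) := by
  refine subsingleton_of_forall_eq 0 fun x ↦ ?_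
  obtain ⟨y, rfl⟩ := contravariant_sequence_exact₃ hS Y x (eq_zero_of_projective _) (add_zero 1)
  obtain ⟨f, rfl⟩ := (mk₀_bijective _ _).surjective y
  obtain ⟨g, rfl⟩ := h f
  rw [← mk₀_comp_mk₀, hS.extClass_comp_assoc]

lemma subsingleton_of_exists_lift (hS : S.ShortExact) [Injective S.X₂] {X : 𝓨}
    (h : ∀ f : X ⟶ S.X₃, ∃ g : X ⟶ S.X₂, g ≫ S.g = f) : Subsingleton (Ext X S.X₁ 1) := by
  refine subsingleton_of_forall_eq 0 fun x ↦ ?_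
  obtain ⟨y, rfl⟩ := covariant_sequence_exact₁ X hS x (eq_zero_of_injective _) (zero_add 1)
  obtain ⟨f, rfl⟩ := (mk₀_bijective _ _).surjective y
  obtain ⟨g, rfl⟩ := h f
  rw [← mk₀_comp_mk₀, comp_assoc_of_second_deg_zero, hS.comp_extClass, comp_zero]

lemma subsingleton_left_of_shortExact (hS : S.ShortExact) {Y : 𝓨} {n m : ℕ} (hnm : 1 + n = m)
    (h₂ : Subsingleton (Ext S.X₂ Y n)) (h₃ : Subsingleton (Ext S.X₃ Y m)) :
    Subsingleton (Ext S.X₁ Y n) := by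
  refine subsingleton_of_forall_eq 0 fun x ↦ ?_
  obtain ⟨y, rfl⟩ := contravariant_sequence_exact₁ hS Y x hnm (Subsingleton.elim _ _)
  rw [Subsingleton.elim y 0, comp_zero]

lemma subsingleton_right_of_shortExact (hS : S.ShortExact) {X : 𝓨} {n m : ℕ} (hnm : n + 1 = m)
    (h₂ : Subsingleton (Ext X S.X₂ n)) (h₁ : Subsingleton (Ext X S.X₁ m)) :
    Subsingleton (Ext X S.X₃ n) := by
  refine subsingleton_of_forall_eq 0 fun x ↦ ?_
  obtain ⟨y, rfl⟩ := covariant_sequence_exact₃ X hS x hnm (Subsingleton.elim _ _)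
  rw [Subsingleton.elim y 0, zero_comp]

end

section

variable {𝓜 : Type u} [Category.{v} 𝓜] [Abelian 𝓜] [HasExt.{w} 𝓜]
  {𝓧 : Type u'} [Category.{v'} 𝓧] [Abelian 𝓧] [HasExt.{w'} 𝓧]

/-- If `F` is exact with right adjoint `G`, then `Ext¹(A, G X)` vanishes when
`Ext¹(F A, X)` does. -/
lemma subsingleton_rightAdjoint_obj [EnoughProjectives 𝓜] {F : 𝓜 ⥤ 𝓧} {G : 𝓧 ⥤ 𝓜}
    (adj : F ⊣ G) [F.PreservesZeroMorphisms] [PreservesFiniteLimits F] [PreservesFiniteColimits F]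
    {A : 𝓜} {X : 𝓧} (h : Subsingleton (Ext (F.obj A) X 1)) :
    Subsingleton (Ext A (G.obj X) 1) := by
  have hS : (ShortComplex.mk (kernel.ι (Projective.π A)) (Projective.π A)
      (kernel.condition _)).ShortExact :=
    { exact := ShortComplex.exact_kernel _ }
  have : Projective (ShortComplex.mk (kernel.ι (Projective.π A)) (Projective.π A)
      (kernel.condition _)).X₂ := Projective.projective_over A
  refine subsingleton_of_exists_extension hS fun f ↦ ?_
  obtain ⟨g, hg⟩ := exists_extension_of_subsingleton (hS.map_of_exact F) h
    ((adj.homEquiv _ _).symm f)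
  exact ⟨adj.homEquiv _ _ g, (adj.homEquiv_naturality_left _ g).symm.trans
    ((Equiv.eq_symm_apply _).mp hg)⟩

/-- If `G` is exact with left adjoint `F`, then `Ext¹(F X, B)` vanishes when
`Ext¹(X, G B)` does. -/
lemma subsingleton_leftAdjoint_obj [EnoughInjectives 𝓜] {F : 𝓧 ⥤ 𝓜} {G : 𝓜 ⥤ 𝓧}
    (adj : F ⊣ G) [G.PreservesZeroMorphisms] [PreservesFiniteLimits G] [PreservesFiniteColimits G]
    {X : 𝓧} {B : 𝓜} (h : Subsingleton (Ext X (G.obj B) 1)) :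
    Subsingleton (Ext (F.obj X) B 1) := by
  have hS : (ShortComplex.mk (Injective.ι B) (cokernel.π (Injective.ι B))
      (cokernel.condition _)).ShortExact :=
    { exact := ShortComplex.exact_cokernel _ }
  have : Injective (ShortComplex.mk (Injective.ι B) (cokernel.π (Injective.ι B))
      (cokernel.condition _)).X₂ := Injective.injective_under B
  refine subsingleton_of_exists_lift hS fun f ↦ ?_
  obtain ⟨g, hg⟩ := exists_lift_of_subsingleton (hS.map_of_exact G) h (adj.homEquiv _ _ f)
  exact ⟨(adj.homEquiv _ _).symm g, (adj.homEquiv_naturality_right_symm g _).symm.trans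
    ((Equiv.symm_apply_eq _).mpr hg)⟩

end

end CategoryTheory.Abelian.Ext

theorem phi_psi_compatible
    {𝓜 : Type u} [Category.{v} 𝓜] [Abelian 𝓜]
    [EnoughProjectives 𝓜] [EnoughInjectives 𝓜] [HasExt.{w} 𝓜]
    {𝓧 : Type u'} [Category.{v'} 𝓧] [Abelian 𝓧]
    [EnoughProjectives 𝓧] [EnoughInjectives 𝓧] [HasExt.{w'} 𝓧]
    {J : Type*} (Cf Kf : J → (𝓧 ⥤ 𝓜)) (Sf : J → (𝓜 ⥤ 𝓧))
    [∀ j, (Cf j).Additive] [∀ j, (Kf j).Additive]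
    (adjCS : ∀ j, Cf j ⊣ Sf j) (adjSK : ∀ j, Sf j ⊣ Kf j)
    (𝓐 𝓑 : Set 𝓜) (h : IsCotorsionPair 𝓐 𝓑)
    (hComp1 : ∀ F ∈ Phi Cf 𝓐, ∀ P ∈ Psi Kf 𝓑, Subsingleton (Ext F P 1))
    (hEx : EL Cf = ER Kf)
    (hSeq1 : ∀ (j : J), ∀ A ∈ 𝓐, ∃ (Rob U : 𝓧) (i : (Sf j).obj A ⟶ Rob) (p : Rob ⟶ U)
      (w : i ≫ p = 0), (ShortComplex.mk i p w).ShortExact ∧ Rob ∈ Phi Cf 𝓐 ∧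
      ∀ E ∈ ER Kf, Subsingleton (Ext U E 2))
    (hSeq2 : ∀ (j : J), ∀ B ∈ 𝓑, ∃ (W T : 𝓧) (i : W ⟶ T) (p : T ⟶ (Sf j).obj B)
      (w : i ≫ p = 0), (ShortComplex.mk i p w).ShortExact ∧ T ∈ Psi Kf 𝓑 ∧
      ∀ E ∈ EL Cf, Subsingleton (Ext E W 2)) :
    (∀ F ∈ Phi Cf 𝓐, ∀ P ∈ Psi Kf 𝓑, Subsingleton (Ext F P 1)) ∧
    Phi Cf 𝓐 ∩ rightPerp (Phi Cf 𝓐) = leftPerp (Psi Kf 𝓑) ∩ Psi Kf 𝓑 := by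
  have : ∀ j, (Sf j).Additive := fun j ↦ (adjCS j).right_adjoint_additive
  have : ∀ j, PreservesFiniteLimits (Sf j) := fun j ↦
    have := (adjCS j).rightAdjoint_preservesLimits
    inferInstance
  have : ∀ j, PreservesFiniteColimits (Sf j) := fun j ↦
    have := (adjSK j).leftAdjoint_preservesColimits
    inferInstance
  refine ⟨hComp1, Set.Subset.antisymm ?_ ?_⟩
  · rintro X ⟨hX, hX'⟩
    have hER : X ∈ ER Kf := hEx ▸ (fun j ↦ (hX j).2 : X ∈ EL Cf)
    refine ⟨hComp1 X hX, fun j ↦ ⟨?_, hER j⟩⟩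
    rw [← h.2]
    intro A hA
    obtain ⟨R, U, i, p, w, hS, hR, hU⟩ := hSeq1 j A hA
    exact Ext.subsingleton_rightAdjoint_obj (adjSK j)
      (Ext.subsingleton_left_of_shortExact hS rfl (hX' R hR) (hU X hER))
  · rintro X ⟨hX', hX⟩
    have hEL : X ∈ EL Cf := hEx ▸ (fun j ↦ (hX j).2 : X ∈ ER Kf)
    refine ⟨fun j ↦ ⟨?_, hEL j⟩, fun F hF ↦ hComp1 F hF X hX⟩
    rw [h.1]
    intro B hB
    obtain ⟨W, T, i, p, w, hS, hT, hW⟩ := hSeq2 j B hB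
    exact Ext.subsingleton_leftAdjoint_obj (adjCS j)
      (Ext.subsingleton_right_of_shortExact hS rfl (hX' T hT) (hW X hEL))
end

section
/- In the abstract setup, let (𝓐, 𝓑) be a cotorsion pair in 𝓜, and assume conditions (Comp1), (Ex) and (Seq) hold; write 𝓔 = 𝓔_L = 𝓔_R. Then ⊥Ψ(𝓑) ∩ 𝓔 = Φ(𝓐). -/
/-!
Statement 9 (Equation (1.1) in the proof of Theorem 1.14): under conditions (Comp1), (Ex) and (Seq), `⊥Ψ(𝓑) ∩ 𝓔 = Φ(𝓐)` (here `𝓔 = 𝓔_L = 𝓔_R`).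
(Holm–Jørgensen, "Model categories of quiver representations".)
-/

open CategoryTheory CategoryTheory.Limits CategoryTheory.Abelian

universe w w' v u v' u'

/-- `Ext¹(X, Y)` vanishes if `Y` is the third term of a short exact sequence `S` with
`Ext¹(X, S.X₂) = 0` and `Ext²(X, S.X₁) = 0`. -/
lemma subsingleton_ext_one_of_shortExact {C : Type u} [Category.{v} C] [Abelian C] [HasExt.{w} C]
    {S : ShortComplex C} (hS : S.ShortExact) (X : C)
    (h₂ : Subsingleton (Ext X S.X₂ 1)) (h₁ : Subsingleton (Ext X S.X₁ 2)) :
    Subsingleton (Ext X S.X₃ 1) := by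
  refine subsingleton_of_forall_eq 0 fun x => ?_
  obtain ⟨y, rfl⟩ := Ext.covariant_sequence_exact₃ X hS x (n₁ := 2) rfl (Subsingleton.elim _ _)
  rw [Subsingleton.elim y 0, Ext.zero_comp]

/-- If `F ⊣ G` with `G` exact and the source of `G` has enough injectives, then the vanishing of
`Ext¹(X, G B)` implies that of `Ext¹(F X, B)`. -/
lemma subsingleton_ext_one_of_adjunction {C : Type u} [Category.{v} C] [Abelian C]
    [EnoughInjectives C] [HasExt.{w} C] {D : Type u'} [Category.{v'} D] [Abelian D]
    [HasExt.{w'} D] {F : D ⥤ C} {G : C ⥤ D} (adj : F ⊣ G) [G.Additive]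
    [PreservesFiniteLimits G] [PreservesFiniteColimits G] (X : D) (B : C)
    (hX : Subsingleton (Ext X (G.obj B) 1)) : Subsingleton (Ext (F.obj X) B 1) := by
  refine subsingleton_of_forall_eq 0 fun x => ?_
  let S : ShortComplex C :=
    ShortComplex.mk (Injective.ι B) (cokernel.π (Injective.ι B)) (cokernel.condition _)
  have hS : S.ShortExact := { exact := ShortComplex.exact_cokernel (Injective.ι B) }
  have hGS : (S.map G).ShortExact := hS.map_of_exact G
  obtain ⟨q, rfl⟩ := Ext.covariant_sequence_exact₁ (F.obj X) hS x
    (Ext.eq_zero_of_injective (I := Injective.under B) (n := 0) _) rfl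
  obtain ⟨f, rfl⟩ := (Ext.mk₀_bijective _ _).2 q
  obtain ⟨t, ht⟩ := Ext.covariant_sequence_exact₃ X hGS
    (Ext.mk₀ (adj.homEquiv X S.X₃ f)) (n₁ := 1) rfl (hX.elim _ _)
  obtain ⟨g, rfl⟩ : ∃ g : X ⟶ G.obj S.X₂, Ext.mk₀ g = t := (Ext.mk₀_bijective _ _).2 t
  have hg : g ≫ G.map S.g = adj.homEquiv X S.X₃ f :=
    (Ext.mk₀_bijective _ _).1 ((Ext.mk₀_comp_mk₀ _ _).symm.trans ht)
  have hf : f = (adj.homEquiv X S.X₂).symm g ≫ S.g := by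
    rw [← adj.homEquiv_naturality_right_symm, hg, Equiv.symm_apply_apply]
  rw [hf, ← Ext.mk₀_comp_mk₀, Ext.comp_assoc_of_second_deg_zero, hS.comp_extClass, Ext.comp_zero]

theorem leftPerp_psi_inter_E
    {𝓜 : Type u} [Category.{v} 𝓜] [Abelian 𝓜]
    [EnoughProjectives 𝓜] [EnoughInjectives 𝓜] [HasExt.{w} 𝓜]
    {𝓧 : Type u'} [Category.{v'} 𝓧] [Abelian 𝓧]
    [EnoughProjectives 𝓧] [EnoughInjectives 𝓧] [HasExt.{w'} 𝓧]
    {J : Type*} (Cf Kf : J → (𝓧 ⥤ 𝓜)) (Sf : J → (𝓜 ⥤ 𝓧))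
    [∀ j, (Cf j).Additive] [∀ j, (Kf j).Additive]
    (adjCS : ∀ j, Cf j ⊣ Sf j) (adjSK : ∀ j, Sf j ⊣ Kf j)
    (𝓐 𝓑 : Set 𝓜) (h : IsCotorsionPair 𝓐 𝓑)
    (hComp1 : ∀ F ∈ Phi Cf 𝓐, ∀ P ∈ Psi Kf 𝓑, Subsingleton (Ext F P 1))
    (hEx : EL Cf = ER Kf)
    (hSeq1 : ∀ (j : J), ∀ A ∈ 𝓐, ∃ (Rob U : 𝓧) (i : (Sf j).obj A ⟶ Rob) (p : Rob ⟶ U)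
      (w : i ≫ p = 0), (ShortComplex.mk i p w).ShortExact ∧ Rob ∈ Phi Cf 𝓐 ∧
      ∀ E ∈ ER Kf, Subsingleton (Ext U E 2))
    (hSeq2 : ∀ (j : J), ∀ B ∈ 𝓑, ∃ (W T : 𝓧) (i : W ⟶ T) (p : T ⟶ (Sf j).obj B)
      (w : i ≫ p = 0), (ShortComplex.mk i p w).ShortExact ∧ T ∈ Psi Kf 𝓑 ∧
      ∀ E ∈ EL Cf, Subsingleton (Ext E W 2)) :
    leftPerp (Psi Kf 𝓑) ∩ EL Cf = Phi Cf 𝓐 := by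
  refine Set.Subset.antisymm ?_ fun X hX => ⟨fun P hP => hComp1 X hX P hP, fun j => (hX j).2⟩
  rintro X ⟨hX, hXE⟩ j
  refine ⟨?_, hXE j⟩
  rw [h.1]
  intro B hB
  have := (adjCS j).isRightAdjoint
  have := (adjSK j).isLeftAdjoint
  have := (adjCS j).right_adjoint_additive
  have := (adjCS j).rightAdjoint_preservesLimits
  have := (adjSK j).leftAdjoint_preservesColimits
  obtain ⟨W, T, i, p, w, hS, hT, hW⟩ := hSeq2 j B hB
  exact subsingleton_ext_one_of_adjunction (adjCS j) X B
    (subsingleton_ext_one_of_shortExact hS X (hX T hT) (hW X hXE))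
end

section
/- In the abstract setup, let (𝓐, 𝓑) be a cotorsion pair in 𝓜, and assume conditions (Comp1), (Ex) and (Seq) hold; write 𝓔 = 𝓔_L = 𝓔_R. Then Φ(𝓐)^⊥ ∩ 𝓔 = Ψ(𝓑). -/
/-!
Statement 10 (Equation (1.2) in the proof of Theorem 1.14): under conditions (Comp1), (Ex) and (Seq), `Φ(𝓐)^⊥ ∩ 𝓔 = Ψ(𝓑)` (here `𝓔 = 𝓔_L = 𝓔_R`).
(Holm–Jørgensen, "Model categories of quiver representations".)
-/

open CategoryTheory CategoryTheory.Limits CategoryTheory.Abelian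

universe w w' v u v' u'

section Aux

variable {𝓜 : Type u} [Category.{v} 𝓜] [Abelian 𝓜] [HasExt.{w} 𝓜]
variable {𝓧 : Type u'} [Category.{v'} 𝓧] [Abelian 𝓧] [HasExt.{w'} 𝓧]

/-- If `Ext¹` vanishes on the quotient, morphisms extend along a monomorphism. -/
lemma exists_extension_of_subsingleton_ext {S : ShortComplex 𝓧} (hS : S.ShortExact) {Y : 𝓧}
    (hY : Subsingleton (Ext S.X₃ Y 1)) (f : S.X₁ ⟶ Y) : ∃ g : S.X₂ ⟶ Y, S.f ≫ g = f := by
  obtain ⟨x, hx⟩ := Ext.contravariant_sequence_exact₁ hS Y (Ext.mk₀ f) (add_zero 1)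
    (Subsingleton.elim _ _)
  obtain ⟨g, rfl⟩ := (Ext.mk₀_bijective _ _).2 x
  refine ⟨g, (Ext.mk₀_bijective _ _).1 ?_⟩
  rw [← hx, Ext.mk₀_comp_mk₀]

/-- `Ext¹` vanishes if all morphisms extend along the kernel of an epimorphism from a
projective object. -/
lemma subsingleton_ext_of_exists_extension {S : ShortComplex 𝓜} (hS : S.ShortExact)
    [Projective S.X₂] {Y : 𝓜} (hY : ∀ f : S.X₁ ⟶ Y, ∃ g : S.X₂ ⟶ Y, S.f ≫ g = f) :
    Subsingleton (Ext S.X₃ Y 1) := by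
  refine subsingleton_of_forall_eq 0 fun x ↦ ?_
  obtain ⟨y, rfl⟩ := Ext.contravariant_sequence_exact₃ hS Y x
    (Ext.eq_zero_of_projective _) (add_zero 1)
  obtain ⟨f, rfl⟩ := (Ext.mk₀_bijective _ _).2 y
  obtain ⟨g, rfl⟩ := hY f
  rw [← Ext.mk₀_comp_mk₀, hS.extClass_comp_assoc]

/-- If `F ⊣ G` with `F` exact, then `Ext¹(F A, X) = 0` implies `Ext¹(A, G X) = 0`. -/
lemma subsingleton_ext_of_adjunction [EnoughProjectives 𝓜] {F : 𝓜 ⥤ 𝓧} {G : 𝓧 ⥤ 𝓜}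
    (adj : F ⊣ G) [F.PreservesZeroMorphisms] [PreservesFiniteLimits F] [PreservesFiniteColimits F]
    {A : 𝓜} {X : 𝓧} (hX : Subsingleton (Ext (F.obj A) X 1)) :
    Subsingleton (Ext A (G.obj X) 1) := by
  let S : ShortComplex 𝓜 := ShortComplex.mk (kernel.ι (Projective.π A)) (Projective.π A) (by simp)
  have hS : S.ShortExact :=
    { exact := ShortComplex.exact_kernel _
      mono_f := inferInstanceAs (Mono (kernel.ι _))
      epi_g := inferInstanceAs (Epi (Projective.π A)) }
  have : Projective S.X₂ := inferInstanceAs (Projective (Projective.over A))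
  refine subsingleton_ext_of_exists_extension hS fun f ↦ ?_
  obtain ⟨g, hg⟩ := exists_extension_of_subsingleton_ext (hS.map_of_exact F) hX
    ((adj.homEquiv _ _).symm f)
  exact ⟨adj.homEquiv S.X₂ X g,
    (adj.homEquiv_naturality_left S.f g).symm.trans ((Equiv.eq_symm_apply _).1 hg)⟩

end Aux

theorem rightPerp_phi_inter_E
    {𝓜 : Type u} [Category.{v} 𝓜] [Abelian 𝓜]
    [EnoughProjectives 𝓜] [EnoughInjectives 𝓜] [HasExt.{w} 𝓜]
    {𝓧 : Type u'} [Category.{v'} 𝓧] [Abelian 𝓧]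
    [EnoughProjectives 𝓧] [EnoughInjectives 𝓧] [HasExt.{w'} 𝓧]
    {J : Type*} (Cf Kf : J → (𝓧 ⥤ 𝓜)) (Sf : J → (𝓜 ⥤ 𝓧))
    [∀ j, (Cf j).Additive] [∀ j, (Kf j).Additive]
    (adjCS : ∀ j, Cf j ⊣ Sf j) (adjSK : ∀ j, Sf j ⊣ Kf j)
    (𝓐 𝓑 : Set 𝓜) (h : IsCotorsionPair 𝓐 𝓑)
    (hComp1 : ∀ F ∈ Phi Cf 𝓐, ∀ P ∈ Psi Kf 𝓑, Subsingleton (Ext F P 1))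
    (hEx : EL Cf = ER Kf)
    (hSeq1 : ∀ (j : J), ∀ A ∈ 𝓐, ∃ (Rob U : 𝓧) (i : (Sf j).obj A ⟶ Rob) (p : Rob ⟶ U)
      (w : i ≫ p = 0), (ShortComplex.mk i p w).ShortExact ∧ Rob ∈ Phi Cf 𝓐 ∧
      ∀ E ∈ ER Kf, Subsingleton (Ext U E 2))
    (hSeq2 : ∀ (j : J), ∀ B ∈ 𝓑, ∃ (W T : 𝓧) (i : W ⟶ T) (p : T ⟶ (Sf j).obj B)
      (w : i ≫ p = 0), (ShortComplex.mk i p w).ShortExact ∧ T ∈ Psi Kf 𝓑 ∧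
      ∀ E ∈ EL Cf, Subsingleton (Ext E W 2)) :
    rightPerp (Phi Cf 𝓐) ∩ EL Cf = Psi Kf 𝓑 := by
  ext X
  constructor
  · rintro ⟨hX, hE⟩ j
    have hR : X ∈ ER Kf := hEx ▸ hE
    refine ⟨?_, hR j⟩
    rw [← h.2]
    intro A hA
    obtain ⟨R, U, i, p, w, hS, hRΦ, hU⟩ := hSeq1 j A hA
    have := (adjCS j).rightAdjoint_preservesLimits
    have := (adjSK j).leftAdjoint_preservesColimits
    have := (adjSK j).left_adjoint_additive
    refine subsingleton_ext_of_adjunction (adjSK j) (subsingleton_of_forall_eq 0 fun x ↦ ?_)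
    obtain ⟨y, rfl⟩ := Ext.contravariant_sequence_exact₁ hS X x (n₁ := 2) rfl
      ((hU X hR).elim _ _)
    rw [(hX R hRΦ).elim y 0, Ext.comp_zero]
  · intro hX
    refine ⟨fun F hF ↦ hComp1 F hF X hX, ?_⟩
    rw [hEx]
    exact fun j ↦ (hX j).2
end

section
/- In the abstract setup, let 𝓒 be a class of objects of 𝓜 such that for each non-zero M ∈ 𝓜 there is an injective object I of 𝓜 which belongs to 𝓒 and satisfies Hom_𝓜(M, I) ≠ 0. If (𝓐, 𝓑) is the cotorsion pair in 𝓜 cogenerated by 𝓒 (i.e. 𝓐 = ⊥𝓒 and 𝓑 = 𝓐^⊥), then (Φ(𝓐), Φ(𝓐)^⊥) is the cotorsion pair in 𝓧 cogenerated by {S_j(C) | j ∈ J, C ∈ 𝓒}; that is, Φ(𝓐) = ⊥{S_j(C) | j ∈ J, C ∈ 𝓒}. -/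
/-!
Statement 11 (Lemma 1.15(i)): if the cotorsion pair `(𝓐, 𝓑)` in `𝓜` is cogenerated by `𝓒`, then `(Φ(𝓐), Φ(𝓐)^⊥)` is the cotorsion pair in `𝓧` cogenerated by `{S_j(C) | j ∈ J, C ∈ 𝓒}`.
(Holm–Jørgensen, "Model categories of quiver representations".)
-/

open CategoryTheory CategoryTheory.Limits CategoryTheory.Abelian

universe w w' v u v' u'

/-- Every map `T.X₂ ⟶ D` killing `T.X₁` factors through `T.X₃`. -/
def FactorsThroughLast {𝓨 : Type u} [Category.{v} 𝓨] [Abelian 𝓨] (T : ShortComplex 𝓨) (D : 𝓨) :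
    Prop :=
  ∀ f : T.X₂ ⟶ D, T.f ≫ f = 0 → ∃ g : T.X₃ ⟶ D, T.g ≫ g = f

/-- Given an exact sequence `T.X₁ ⟶ T.X₂ ⟶ T.X₃ ⟶ Y ⟶ 0` with `T.X₃` projective, `Ext¹(Y, D)`
vanishes if and only if every map `T.X₂ ⟶ D` killing `T.X₁` factors through `T.X₃`. -/
lemma subsingleton_ext_one_iff {𝓨 : Type u} [Category.{v} 𝓨] [Abelian 𝓨] [HasExt.{w} 𝓨]
    {T : ShortComplex 𝓨} (hT : T.Exact) [Projective T.X₃] {Y : 𝓨} {c : T.X₃ ⟶ Y} (hc' : Epi c)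
    {hc : T.g ≫ c = 0} (hTc : (ShortComplex.mk T.g c hc).Exact) (D : 𝓨) :
    Subsingleton (Ext Y D 1) ↔ FactorsThroughLast T D := by
  let e : T.X₂ ⟶ kernel c := kernel.lift c T.g hc
  have he : e ≫ kernel.ι c = T.g := kernel.lift_ι _ _ _
  have hTe : T.f ≫ e = 0 := by
    rw [← cancel_mono (kernel.ι c), Category.assoc, he, T.zero, zero_comp]
  have : Epi e := (ShortComplex.mk T.g c hc).exact_iff_epi_kernel_lift.1 hTc
  have hS : (ShortComplex.mk (kernel.ι c) c (kernel.condition c)).ShortExact :=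
    { exact := ShortComplex.exact_kernel c }
  have hE : (ShortComplex.mk T.f e hTe).Exact := by
    let φ : ShortComplex.mk T.f e hTe ⟶ T :=
      { τ₁ := 𝟙 _, τ₂ := 𝟙 _, τ₃ := kernel.ι c }
    have : Epi φ.τ₁ := inferInstanceAs (Epi (𝟙 _))
    have : IsIso φ.τ₂ := inferInstanceAs (IsIso (𝟙 _))
    have : Mono φ.τ₃ := inferInstanceAs (Mono (kernel.ι c))
    exact (ShortComplex.exact_iff_of_epi_of_isIso_of_mono φ).2 hT
  constructor
  · intro _ f hf
    obtain ⟨f', hf'⟩ : ∃ f' : kernel c ⟶ D, e ≫ f' = f :=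
      ⟨hE.desc f hf, hE.g_desc f hf⟩
    obtain ⟨x, hx⟩ := Ext.contravariant_sequence_exact₁ hS D (Ext.mk₀ f') (add_zero 1)
      (Subsingleton.elim _ _)
    obtain ⟨g, rfl⟩ := Ext.mk₀_bijective _ _ |>.2 x
    refine ⟨g, ?_⟩
    rw [Ext.mk₀_comp_mk₀] at hx
    have hg : kernel.ι c ≫ g = f' := (Ext.mk₀_bijective _ _).1 hx
    rw [← he, Category.assoc, hg, hf']
  · intro H
    refine subsingleton_of_forall_eq 0 fun x ↦ ?_
    obtain ⟨y, rfl⟩ := Ext.contravariant_sequence_exact₃ hS D x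
      (Ext.eq_zero_of_projective (n := 0) _) (add_zero 1)
    obtain ⟨k, rfl⟩ := Ext.mk₀_bijective _ _ |>.2 y
    obtain ⟨g, hg⟩ := H (e ≫ k) (by rw [reassoc_of% hTe, zero_comp])
    have hk : k = kernel.ι c ≫ g := by
      rw [← cancel_epi e, ← hg, reassoc_of% he]
    rw [hk, ← Ext.mk₀_comp_mk₀]
    exact hS.extClass_comp_assoc _

/-- A short complex is exact if every map from its middle term to an injective object of a
cogenerating class which kills the first term factors through the last one. -/
lemma exact_of_forall_injective_factors {𝓨 : Type u} [Category.{v} 𝓨] [Abelian 𝓨] (𝓒 : Set 𝓨)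
    (h𝓒 : ∀ M : 𝓨, ¬ IsZero M → ∃ I : 𝓨, Injective I ∧ I ∈ 𝓒 ∧ ∃ f : M ⟶ I, f ≠ 0)
    (T : ShortComplex 𝓨)
    (H : ∀ I ∈ 𝓒, FactorsThroughLast T I) : T.Exact := by
  rw [ShortComplex.exact_iff_isZero_homology]
  by_contra hT
  obtain ⟨I, _, hI, f, hf⟩ := h𝓒 _ hT
  obtain ⟨g, hg⟩ := H I hI (T.pOpcycles ≫ Injective.factorThru f T.homologyι) (by simp)
  have hg' : T.fromOpcycles ≫ g = Injective.factorThru f T.homologyι := by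
    simp [← cancel_epi T.pOpcycles, hg]
  exact hf (by rw [← Injective.comp_factorThru f T.homologyι, ← hg',
    T.homologyι_comp_fromOpcycles_assoc, zero_comp])

/-- The first left derived functor of `F` vanishes at `X` if and only if `F` preserves exactness
of a projective resolution of `X` in degree one. -/
lemma isZero_leftDerived_one_iff {𝓨 : Type u} [Category.{v} 𝓨] [Abelian 𝓨]
    {𝓩 : Type u'} [Category.{v'} 𝓩] [Abelian 𝓩] [HasProjectiveResolutions 𝓩]
    (F : 𝓩 ⥤ 𝓨) [F.Additive] {X : 𝓩} (P : ProjectiveResolution X) :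
    IsZero ((F.leftDerived 1).obj X) ↔ ((P.complex.sc' 2 1 0).map F).Exact := by
  rw [(P.isoLeftDerivedObj F 1).isZero_iff]
  refine (HomologicalComplex.exactAt_iff_isZero_homology _ _).symm.trans ?_
  exact HomologicalComplex.exactAt_iff' _ 2 1 0 (by simp) (by simp)

lemma leftPerp_rightPerp_leftPerp {𝓨 : Type u} [Category.{v} 𝓨] [Abelian 𝓨] [HasExt.{w} 𝓨]
    (Δ : Set 𝓨) : leftPerp (rightPerp (leftPerp Δ)) = leftPerp Δ :=
  Set.Subset.antisymm (fun _ hY D hD ↦ hY D fun _ hC ↦ hC D hD) fun _ hY _ hD ↦ hD _ hY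

lemma factorsThroughLast_map_iff {𝓨 : Type u} [Category.{v} 𝓨] [Abelian 𝓨]
    {𝓩 : Type u'} [Category.{v'} 𝓩] [Abelian 𝓩]
    {F : 𝓩 ⥤ 𝓨} {G : 𝓨 ⥤ 𝓩} (adj : F ⊣ G) [F.Additive] (T : ShortComplex 𝓩) (D : 𝓨) :
    FactorsThroughLast (T.map F) D ↔ FactorsThroughLast T (G.obj D) := by
  have := adj.right_adjoint_additive
  change (∀ f : F.obj T.X₂ ⟶ D, F.map T.f ≫ f = 0 →
    ∃ g : F.obj T.X₃ ⟶ D, F.map T.g ≫ g = f) ↔ _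
  constructor
  · intro H f hf
    obtain ⟨g, hg⟩ := H ((adj.homEquiv _ _).symm f) (by
      rw [← adj.homEquiv_naturality_left_symm, hf, adj.homEquiv_counit, F.map_zero, zero_comp])
    exact ⟨adj.homEquiv _ _ g, by
      rw [← adj.homEquiv_naturality_left, hg, Equiv.apply_symm_apply]⟩
  · intro H f hf
    obtain ⟨g, hg⟩ := H (adj.homEquiv _ _ f) (by
      rw [← adj.homEquiv_naturality_left, hf, adj.homEquiv_unit, G.map_zero, comp_zero])
    exact ⟨(adj.homEquiv _ _).symm g, by
      rw [← adj.homEquiv_naturality_left_symm, hg, Equiv.symm_apply_apply]⟩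

/-- For an adjunction `F ⊣ G`, the vanishing of `Ext¹(X, G(D))` is a factorization property for
`F` applied to a projective resolution of `X`. -/
lemma subsingleton_ext_one_rightAdjoint_iff {𝓨 : Type u} [Category.{v} 𝓨] [Abelian 𝓨]
    {𝓩 : Type u'} [Category.{v'} 𝓩] [Abelian 𝓩] [HasExt.{w'} 𝓩]
    {F : 𝓩 ⥤ 𝓨} {G : 𝓨 ⥤ 𝓩} (adj : F ⊣ G) [F.Additive] {X : 𝓩} (P : ProjectiveResolution X)
    (D : 𝓨) :
    Subsingleton (Ext X (G.obj D) 1) ↔ FactorsThroughLast ((P.complex.sc' 2 1 0).map F) D := by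
  have : Projective (P.complex.sc' 2 1 0).X₃ := P.projective 0
  let ε : P.complex.X 0 ⟶ X := P.π.f 0
  have hε : Epi ε := epi_of_isColimit_cofork P.isColimitCokernelCofork
  exact (subsingleton_ext_one_iff (T := P.complex.sc' 2 1 0) (P.exact_succ 0) (c := ε) hε
    P.exact₀ _).trans (factorsThroughLast_map_iff adj _ D).symm

/-- If `F` is right exact, preserves projective objects, and stays exact on a projective
resolution of `X` in degree one, then `Ext¹(F(X), D)` can be computed by applying `F` to that
resolution. -/
lemma subsingleton_ext_one_obj_iff {𝓨 : Type u} [Category.{v} 𝓨] [Abelian 𝓨] [HasExt.{w} 𝓨]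
    {𝓩 : Type u'} [Category.{v'} 𝓩] [Abelian 𝓩]
    (F : 𝓩 ⥤ 𝓨) [F.Additive] [PreservesFiniteColimits F] [F.PreservesProjectiveObjects]
    {X : 𝓩} (P : ProjectiveResolution X) (hP : ((P.complex.sc' 2 1 0).map F).Exact) (D : 𝓨) :
    Subsingleton (Ext (F.obj X) D 1) ↔ FactorsThroughLast ((P.complex.sc' 2 1 0).map F) D := by
  have : Projective ((P.complex.sc' 2 1 0).map F).X₃ := F.projective_obj (P.complex.X 0)
  let ε : P.complex.X 0 ⟶ X := P.π.f 0
  have hε : Epi ε := epi_of_isColimit_cofork P.isColimitCokernelCofork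
  exact subsingleton_ext_one_iff (T := (P.complex.sc' 2 1 0).map F) hP (c := F.map ε)
    (inferInstanceAs (Epi (F.map ε)))
    (P.exact₀.map_of_epi_of_preservesCokernel F hε inferInstance) D

theorem phi_cogenerated
    {𝓜 : Type u} [Category.{v} 𝓜] [Abelian 𝓜]
    [EnoughProjectives 𝓜] [EnoughInjectives 𝓜] [HasExt.{w} 𝓜]
    {𝓧 : Type u'} [Category.{v'} 𝓧] [Abelian 𝓧]
    [EnoughProjectives 𝓧] [EnoughInjectives 𝓧] [HasExt.{w'} 𝓧]
    {J : Type*} (Cf Kf : J → (𝓧 ⥤ 𝓜)) (Sf : J → (𝓜 ⥤ 𝓧))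
    [∀ j, (Cf j).Additive] [∀ j, (Kf j).Additive]
    (adjCS : ∀ j, Cf j ⊣ Sf j) (adjSK : ∀ j, Sf j ⊣ Kf j)
    (𝓒 : Set 𝓜)
    (h𝓒 : ∀ M : 𝓜, ¬ IsZero M → ∃ I : 𝓜, Injective I ∧ I ∈ 𝓒 ∧ ∃ f : M ⟶ I, f ≠ 0)
    (𝓐 𝓑 : Set 𝓜) (h : IsCotorsionPair 𝓐 𝓑) (hcogen : 𝓐 = leftPerp 𝓒) :
    IsCotorsionPair (Phi Cf 𝓐) (rightPerp (Phi Cf 𝓐)) ∧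
    Phi Cf 𝓐 = leftPerp {Y : 𝓧 | ∃ (j : J), ∃ C ∈ 𝓒, Y = (Sf j).obj C} := by
  have hΦ : Phi Cf 𝓐 = leftPerp {Y : 𝓧 | ∃ (j : J), ∃ C ∈ 𝓒, Y = (Sf j).obj C} := by
    have hproj (j : J) : (Cf j).PreservesProjectiveObjects :=
      have := (adjSK j).leftAdjoint_preservesColimits
      Functor.preservesProjectiveObjects_of_adjunction_of_preservesEpimorphisms (adjCS j)
    have hcolim (j : J) : PreservesFiniteColimits (Cf j) :=
      have := (adjCS j).leftAdjoint_preservesColimits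
      inferInstance
    subst hcogen
    ext X
    let P := projectiveResolution X
    constructor
    · rintro hX _ ⟨j, D, hD, rfl⟩
      have hP := (isZero_leftDerived_one_iff (Cf j) P).1 (hX j).2
      exact (subsingleton_ext_one_rightAdjoint_iff (adjCS j) P D).2
        ((subsingleton_ext_one_obj_iff (Cf j) P hP D).1 ((hX j).1 D hD))
    · intro hX j
      have H (D : 𝓜) (hD : D ∈ 𝓒) :=
        (subsingleton_ext_one_rightAdjoint_iff (adjCS j) P D).1 (hX _ ⟨j, D, hD, rfl⟩)
      have hP : ((P.complex.sc' 2 1 0).map (Cf j)).Exact :=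
        exact_of_forall_injective_factors 𝓒 h𝓒 _ H
      exact ⟨fun D hD ↦ (subsingleton_ext_one_obj_iff (Cf j) P hP D).2 (H D hD),
        (isZero_leftDerived_one_iff (Cf j) P).2 hP⟩
  refine ⟨⟨?_, rfl⟩, hΦ⟩
  rw [hΦ, leftPerp_rightPerp_leftPerp]
end

section
/- In the abstract setup, let 𝓒 be a class of objects of 𝓜 such that for each non-zero M ∈ 𝓜 there is a projective object P of 𝓜 which belongs to 𝓒 and satisfies Hom_𝓜(P, M) ≠ 0. If (𝓐, 𝓑) is the cotorsion pair in 𝓜 generated by 𝓒 (i.e. 𝓑 = 𝓒^⊥ and 𝓐 = ⊥𝓑), then (⊥Ψ(𝓑), Ψ(𝓑)) is the cotorsion pair in 𝓧 generated by {S_j(C) | j ∈ J, C ∈ 𝓒}; that is, Ψ(𝓑) = {S_j(C) | j ∈ J, C ∈ 𝓒}^⊥. -/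
/-!
Statement 12 (Lemma 1.15(ii)): if the cotorsion pair `(𝓐, 𝓑)` in `𝓜` is generated by `𝓒`, then `(⊥Ψ(𝓑), Ψ(𝓑))` is the cotorsion pair in `𝓧` generated by `{S_j(C) | j ∈ J, C ∈ 𝓒}`.
(Holm–Jørgensen, "Model categories of quiver representations".)
-/

open CategoryTheory CategoryTheory.Limits CategoryTheory.Abelian

universe w w' v u v' u'

/-- For a short exact sequence whose middle term is injective, `Ext¹(A, X₁)` vanishes iff every
morphism `A ⟶ X₃` lifts to `X₂`. -/
lemma subsingleton_ext_one_iff_exists_lift {𝓨 : Type u} [Category.{v} 𝓨] [Abelian 𝓨]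
    [HasExt.{w} 𝓨] {S : ShortComplex 𝓨} (hS : S.ShortExact) [Injective S.X₂] (A : 𝓨) :
    Subsingleton (Ext A S.X₁ 1) ↔ ∀ q : A ⟶ S.X₃, ∃ p : A ⟶ S.X₂, p ≫ S.g = q := by
  constructor
  · intro _ q
    obtain ⟨y, hy⟩ := Ext.covariant_sequence_exact₃ A hS (Ext.mk₀ q) (zero_add 1)
      (Subsingleton.elim _ _)
    obtain ⟨p, rfl⟩ := Ext.addEquiv₀.symm.surjective y
    refine ⟨p, Ext.addEquiv₀.symm.injective ?_⟩
    simpa [Ext.addEquiv₀_symm_apply] using hy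
  · intro hlift
    refine subsingleton_of_forall_eq 0 fun x ↦ ?_
    obtain ⟨y, rfl⟩ := Ext.covariant_sequence_exact₁ A hS x (Ext.eq_zero_of_injective _)
      (zero_add 1)
    obtain ⟨q, rfl⟩ := Ext.addEquiv₀.symm.surjective y
    obtain ⟨p, rfl⟩ := hlift q
    rw [Ext.addEquiv₀_symm_apply, ← Ext.mk₀_comp_mk₀, Ext.comp_assoc_of_second_deg_zero,
      hS.comp_extClass, Ext.comp_zero]

/-- Every object embeds in a short exact sequence with injective middle term such that, for a left
exact functor `F`, `R¹F` vanishes on the object iff `F` preserves the epimorphism of the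
sequence. -/
lemma exists_shortExact_injective_isZero_rightDerived_one_iff {𝓨 : Type u} [Category.{v} 𝓨]
    [Abelian 𝓨] [EnoughInjectives 𝓨] (X : 𝓨) :
    ∃ (I Q : 𝓨) (f : X ⟶ I) (g : I ⟶ Q) (w : f ≫ g = 0),
      (ShortComplex.mk f g w).ShortExact ∧ Injective I ∧
      ∀ {𝓩 : Type u'} [Category.{v'} 𝓩] [Abelian 𝓩] (F : 𝓨 ⥤ 𝓩) [F.Additive]
        [PreservesFiniteLimits F],
        IsZero ((F.rightDerived 1).obj X) ↔ Epi (F.map g) := by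
  let R : InjectiveResolution X := injectiveResolution X
  let d₀ := R.cocomplex.d 0 1
  let d₁ := R.cocomplex.d 1 2
  have hd : d₀ ≫ d₁ = 0 := R.cocomplex.d_comp_d 0 1 2
  let ι : X ⟶ R.cocomplex.X 0 := R.ι.f 0
  have hι : ι ≫ d₀ = 0 := R.ι_f_zero_comp_complex_d
  have hw : ι ≫ kernel.lift d₁ d₀ hd = 0 := by
    rw [← cancel_mono (kernel.ι d₁)]
    simpa using hι
  refine ⟨R.cocomplex.X 0, kernel d₁, ι, kernel.lift d₁ d₀ hd, hw, ?_, inferInstance, ?_⟩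
  · have : Mono ι := inferInstanceAs (Mono (R.ι.f 0))
    have : Epi (kernel.lift d₁ d₀ hd) :=
      (ShortComplex.mk d₀ d₁ hd).exact_iff_epi_kernel_lift.1 (R.exact_succ 0)
    have hex : (ShortComplex.mk ι d₀ hι).Exact := R.exact₀
    let φ : ShortComplex.mk ι (kernel.lift d₁ d₀ hd) hw ⟶ ShortComplex.mk ι d₀ hι :=
      { τ₁ := 𝟙 _, τ₂ := 𝟙 _, τ₃ := kernel.ι d₁
        comm₁₂ := (Category.id_comp ι).trans (Category.comp_id ι).symm
        comm₂₃ := (Category.id_comp d₀).trans (kernel.lift_ι d₁ d₀ hd).symm }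
    have : Epi φ.τ₁ := inferInstanceAs (Epi (𝟙 _))
    have : IsIso φ.τ₂ := inferInstanceAs (IsIso (𝟙 _))
    have : Mono φ.τ₃ := inferInstanceAs (Mono (kernel.ι d₁))
    exact { exact := (ShortComplex.exact_iff_of_epi_of_isIso_of_mono φ).2 hex
            mono_f := ‹_›
            epi_g := ‹_› }
  · intro 𝓩 _ _ F _ _
    let T := (ShortComplex.mk d₀ d₁ hd).map F
    have hT : IsZero ((F.rightDerived 1).obj X) ↔ T.Exact := by
      rw [(R.isoRightDerivedObj F 1).isZero_iff]
      exact (HomologicalComplex.exactAt_iff_isZero_homology _ 1).symm.trans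
        (HomologicalComplex.exactAt_iff' _ 0 1 2 (by simp) (by simp))
    have hF : F.map d₀ ≫ F.map d₁ = 0 := by rw [← F.map_comp, hd, F.map_zero]
    have hfac : kernel.lift (F.map d₁) (F.map d₀) hF =
        F.map (kernel.lift d₁ d₀ hd) ≫ (PreservesKernel.iso F d₁).hom := by
      simp
    rw [hT, T.exact_iff_epi_kernel_lift]
    change Epi (kernel.lift (F.map d₁) (F.map d₀) hF) ↔ _
    rw [hfac]
    exact ⟨fun _ ↦ (epi_comp_iff_of_isIso _ _).1 ‹_›, fun _ ↦ epi_comp _ _⟩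

lemma isCotorsionPair_leftPerp_rightPerp_s12 {𝓨 : Type u} [Category.{v} 𝓨] [Abelian 𝓨]
    [HasExt.{w} 𝓨] (Γ : Set 𝓨) : IsCotorsionPair (leftPerp (rightPerp Γ)) (rightPerp Γ) :=
  ⟨rfl, Set.Subset.antisymm (fun _ hY C hC ↦ hY C fun _ hD ↦ hD C hC)
    fun _ hY _ hC ↦ hC _ hY⟩

/-- Let `S ⊣ K` with `S` preserving monomorphisms. If `𝓒` contains enough projectives to detect
non-zero objects, then `Ext¹(S(C), X)` vanishes for all `C ∈ 𝓒` iff `R¹K(X) = 0` and `Ext¹(C, K(X))`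
vanishes for all `C ∈ 𝓒`. -/
lemma mem_rightPerp_and_isZero_rightDerived_one_iff
    {𝓜 : Type u} [Category.{v} 𝓜] [Abelian 𝓜] [HasExt.{w} 𝓜]
    {𝓧 : Type u'} [Category.{v'} 𝓧] [Abelian 𝓧] [EnoughInjectives 𝓧] [HasExt.{w'} 𝓧]
    {S : 𝓜 ⥤ 𝓧} {K : 𝓧 ⥤ 𝓜} [K.Additive] [S.PreservesMonomorphisms] (adj : S ⊣ K) (𝓒 : Set 𝓜)
    (h𝓒 : ∀ M : 𝓜, ¬ IsZero M → ∃ P : 𝓜, Projective P ∧ P ∈ 𝓒 ∧ ∃ f : P ⟶ M, f ≠ 0) (X : 𝓧) :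
    (K.obj X ∈ rightPerp 𝓒 ∧ IsZero ((K.rightDerived 1).obj X)) ↔
      ∀ C ∈ 𝓒, Subsingleton (Ext (S.obj C) X 1) := by
  have : PreservesLimitsOfSize.{0, 0} K := adj.rightAdjoint_preservesLimits
  obtain ⟨I, Q, f, g, w, hE, hI, hR⟩ :=
    exists_shortExact_injective_isZero_rightDerived_one_iff X
  have : Injective (ShortComplex.mk f g w).X₂ := hI
  have : Injective ((ShortComplex.mk f g w).map K).X₂ := adj.map_injective I hI
  have hlift (C : 𝓜) : Subsingleton (Ext (S.obj C) X 1) ↔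
      ∀ q : C ⟶ K.obj Q, ∃ p : C ⟶ K.obj I, p ≫ K.map g = q := by
    refine (subsingleton_ext_one_iff_exists_lift hE (S.obj C)).trans ⟨fun h q ↦ ?_, fun h q ↦ ?_⟩
    · obtain ⟨p, hp⟩ := h ((adj.homEquiv C Q).symm q)
      refine ⟨adj.homEquiv C I p, ?_⟩
      rw [← adj.homEquiv_naturality_right, ← Equiv.eq_symm_apply]
      exact hp
    · obtain ⟨p, hp⟩ := h (adj.homEquiv C Q q)
      refine ⟨(adj.homEquiv C I).symm p, ?_⟩
      dsimp only
      rw [← adj.homEquiv_naturality_right_symm, Equiv.symm_apply_eq]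
      exact hp
  have hK (hg : Epi (K.map g)) (C : 𝓜) : Subsingleton (Ext C (K.obj X) 1) ↔
      ∀ q : C ⟶ K.obj Q, ∃ p : C ⟶ K.obj I, p ≫ K.map g = q := by
    have hmono := hE.mono_f
    have hKE : ((ShortComplex.mk f g w).map K).ShortExact :=
      { exact := hE.exact.map_of_mono_of_preservesKernel K hmono inferInstance
        mono_f := inferInstanceAs (Mono (K.map f))
        epi_g := hg }
    exact subsingleton_ext_one_iff_exists_lift hKE C
  simp only [hlift]
  constructor
  · rintro ⟨hX, hz⟩ C hC
    exact (hK ((hR K).1 hz) C).1 (hX C hC)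
  · intro h
    have hg : Epi (K.map g) := by
      refine Preadditive.epi_of_isZero_cokernel _ ?_
      by_contra hne
      obtain ⟨P, hP, hPC, r, hr⟩ := h𝓒 _ hne
      obtain ⟨p, hp⟩ := h P hPC (Projective.factorThru r (cokernel.π (K.map g)))
      apply hr
      rw [← Projective.factorThru_comp r (cokernel.π (K.map g)), ← hp, Category.assoc,
        cokernel.condition, comp_zero]
    exact ⟨fun C hC ↦ (hK hg C).2 (h C hC), (hR K).2 hg⟩

theorem psi_generated
    {𝓜 : Type u} [Category.{v} 𝓜] [Abelian 𝓜]
    [EnoughProjectives 𝓜] [EnoughInjectives 𝓜] [HasExt.{w} 𝓜]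
    {𝓧 : Type u'} [Category.{v'} 𝓧] [Abelian 𝓧]
    [EnoughProjectives 𝓧] [EnoughInjectives 𝓧] [HasExt.{w'} 𝓧]
    {J : Type*} (Cf Kf : J → (𝓧 ⥤ 𝓜)) (Sf : J → (𝓜 ⥤ 𝓧))
    [∀ j, (Cf j).Additive] [∀ j, (Kf j).Additive]
    (adjCS : ∀ j, Cf j ⊣ Sf j) (adjSK : ∀ j, Sf j ⊣ Kf j)
    (𝓒 : Set 𝓜)
    (h𝓒 : ∀ M : 𝓜, ¬ IsZero M → ∃ P : 𝓜, Projective P ∧ P ∈ 𝓒 ∧ ∃ f : P ⟶ M, f ≠ 0)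
    (𝓐 𝓑 : Set 𝓜) (h : IsCotorsionPair 𝓐 𝓑) (hgen : 𝓑 = rightPerp 𝓒) :
    IsCotorsionPair (leftPerp (Psi Kf 𝓑)) (Psi Kf 𝓑) ∧
    Psi Kf 𝓑 = rightPerp {Y : 𝓧 | ∃ (j : J), ∃ C ∈ 𝓒, Y = (Sf j).obj C} := by
  subst hgen
  have hΨ : Psi Kf (rightPerp 𝓒) =
      rightPerp {Y : 𝓧 | ∃ (j : J), ∃ C ∈ 𝓒, Y = (Sf j).obj C} := by
    ext X
    have key (j : J) : ((Kf j).obj X ∈ rightPerp 𝓒 ∧ IsZero (((Kf j).rightDerived 1).obj X)) ↔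
        ∀ C ∈ 𝓒, Subsingleton (Ext ((Sf j).obj C) X 1) := by
      have := (Sf j).preservesMonomorphisms_of_adjunction (adjCS j)
      exact mem_rightPerp_and_isZero_rightDerived_one_iff (adjSK j) 𝓒 h𝓒 X
    refine (forall_congr' key).trans ⟨?_, fun h j C hC ↦ h _ ⟨j, C, hC, rfl⟩⟩
    rintro h _ ⟨j, C, hC, rfl⟩
    exact h j C hC
  rw [hΨ]
  exact ⟨isCotorsionPair_leftPerp_rightPerp_s12 _, rfl⟩
end
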